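/- For every s ∈ (0,1) there exists a constant C_s < ∞, independent of n, W and z, such that for every z ∈ ℂ: 𝔼[ ‖G(1,n;z)‖^s ] ≤ C_s · W^s, where ‖·‖ is the matrix operator norm (a-priori fractional moment bound). -/

import Mathlib

open MeasureTheory Matrix
open scoped ENNReal NNReal

noncomputable section

namespace RBM

abbrev Mat (W : ℕ) := Matrix (Fin W) (Fin W) ℂ
abbrev MatP (W : ℕ) := Fin W → Fin W → ℂ

abbrev HermParam (W : ℕ) := (Fin W → ℝ) × ({ p : Fin W × Fin W // p.1 < p.2 } → ℂ)

/-- Parametrization of Hermitian matrices by diagonal (real) and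
above-diagonal (complex) entries. -/
def toHerm {W : ℕ} (x : HermParam W) : Mat W :=
  Matrix.of fun i j =>
    if h : i = j then (x.1 i : ℂ)
    else if h2 : i < j then x.2 ⟨(i, j), h2⟩
    else (starRingEnd ℂ) (x.2 ⟨(j, i), lt_of_le_of_ne (not_lt.mp h2) (Ne.symm h)⟩)

/-- Sample space of the Wegner orbital model: `n` Hermitian matrices `V_j`
(given by their parameters) and `n-1` complex matrices `T_j`. -/
abbrev ΩW (n W : ℕ) := (Fin n → HermParam W) × (Fin (n - 1) → MatP W)

/-- The (unnormalized) density `exp(-W tr(Σ V_j^2 + Σ T_j* T_j))`. -/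
def wegnerDensity (n W : ℕ) (ω : ΩW n W) : ℝ≥0∞ :=
  ENNReal.ofReal <| Real.exp <| -(W : ℝ) *
    ((∑ j : Fin n, (Matrix.trace (toHerm (ω.1 j) * toHerm (ω.1 j))).re) +
     (∑ j : Fin (n - 1), (Matrix.trace ((Matrix.of (ω.2 j))ᴴ * Matrix.of (ω.2 j))).re))

/-- Unnormalized Wegner orbital measure: the above density with respect to
Lebesgue (additive Haar) measure on the parameter space. -/
def wegnerRaw (n W : ℕ) : Measure (ΩW n W) := volume.withDensity (wegnerDensity n W)

/-- The Wegner orbital probability measure. -/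
def wegner (n W : ℕ) : Measure (ΩW n W) := (wegnerRaw n W Set.univ)⁻¹ • wegnerRaw n W

def Vm {n W : ℕ} (ω : ΩW n W) (j : ℕ) : Mat W :=
  if h : j < n then toHerm (ω.1 ⟨j, h⟩) else 0

def Tm {n W : ℕ} (ω : ΩW n W) (j : ℕ) : Mat W :=
  if h : j < n - 1 then Matrix.of (ω.2 ⟨j, h⟩) else 0

/-- The block tridiagonal Hamiltonian with diagonal blocks `V_j`,
subdiagonal blocks `-T_j` and superdiagonal blocks `-T_j*`, acting on
`ℂ^(n·W)` whose coordinates are indexed by pairs (block, inner index). -/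
def ham (n W : ℕ) (V T : ℕ → Mat W) : Matrix (Fin n × Fin W) (Fin n × Fin W) ℂ :=
  Matrix.of fun p q =>
    if (p.1 : ℕ) = (q.1 : ℕ) then V (p.1 : ℕ) p.2 q.2
    else if (p.1 : ℕ) = (q.1 : ℕ) + 1 then (-T (q.1 : ℕ)) p.2 q.2
    else if (q.1 : ℕ) = (p.1 : ℕ) + 1 then (-(T (p.1 : ℕ))ᴴ) p.2 q.2
    else 0

def hamOf {n W : ℕ} (ω : ΩW n W) : Matrix (Fin n × Fin W) (Fin n × Fin W) ℂ :=
  ham n W (Vm ω) (Tm ω)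

/-- The resolvent `(H - z)⁻¹`. -/
def resolvent {n W : ℕ} (ω : ΩW n W) (z : ℂ) : Matrix (Fin n × Fin W) (Fin n × Fin W) ℂ :=
  (hamOf ω - z • 1)⁻¹

/-- The `W×W` block of the resolvent at block position `(x,y)`. -/
def Gblock {n W : ℕ} (ω : ΩW n W) (z : ℂ) (x y : Fin n) : Mat W :=
  Matrix.of fun a b => resolvent ω z (x, a) (y, b)

/-- Operator norm (ℓ²→ℓ² norm) of a complex square matrix. -/
def opNorm {ι : Type*} [Fintype ι] [DecidableEq ι] (M : Matrix ι ι ℂ) : ℝ :=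
  ‖Matrix.toEuclideanCLM (𝕜 := ℂ) M‖

/-- The scalar index in `{0, …, nW-1}` of an entry index. -/
def idx {n W : ℕ} (p : Fin n × Fin W) : ℝ := (p.1 : ℕ) * W + (p.2 : ℕ)

end RBM

namespace RBM

lemma quadratic_integral_lower (A B C L : ℝ) (hL : 0 < L) (hA : 0 ≤ A) (hC : 0 ≤ C)
    (hB : B ^ 2 ≤ 4 * A * C) :
    L * A / 4 ≤ ∫ q in (0:ℝ)..L, (A + B * q + C * q ^ 2) := by
  have h : ∫ q in (0:ℝ)..L, (A + B * q + C * q ^ 2) = A * L + B * L ^ 2 / 2 + C * L ^ 3 / 3 := by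
    rw [intervalIntegral.integral_add, intervalIntegral.integral_add]
    · rw [intervalIntegral.integral_const_mul, intervalIntegral.integral_const_mul]
      simp
      ring
    all_goals exact Continuous.intervalIntegrable (by fun_prop) _ _
  rw [h]
  have h1 : 0 ≤ 3 / 4 * A + B * L / 2 + C * L ^ 2 / 3 := by
    rcases hC.eq_or_lt with hC | hC
    · subst hC
      have : B = 0 := by nlinarith
      subst this; simp; positivity
    · have : 0 ≤ (4 * C) * (3 / 4 * A + B * L / 2 + C * L ^ 2 / 3) := by
        nlinarith [sq_nonneg (3 * B + 4 * C * L)]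
      exact nonneg_of_mul_nonneg_right this (by positivity)
  nlinarith [mul_nonneg hL.le h1]

lemma norm_add_mul_sq (p0 p1 : ℂ) (q : ℝ) :
    ‖p0 + p1 * q‖ ^ 2 = ‖p0‖ ^ 2 + (2 * (p0.re * p1.re + p0.im * p1.im)) * q
      + ‖p1‖ ^ 2 * q ^ 2 := by
  simp only [← Complex.normSq_eq_norm_sq, Complex.normSq_apply]
  simp
  ring

lemma value_zero_le_aux (a b : ℝ) (ha : 0 < a) (hb : b ≤ 0) (p0 p1 : ℂ) :
    ENNReal.ofReal (‖p0‖ ^ 2) ≤ ENNReal.ofReal (12 * √a) *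
      ∫⁻ q : ℝ, ENNReal.ofReal (‖p0 + p1 * q‖ ^ 2 * Real.exp (-(a * q ^ 2 + b * q))) := by
  set g : ℝ → ℝ := fun q => ‖p0 + p1 * q‖ ^ 2 * Real.exp (-(a * q ^ 2 + b * q)) with hg
  have hgc : Continuous g := by fun_prop
  have hg0 : ∀ q, 0 ≤ g q := fun q => by positivity
  set L := (√a)⁻¹ with hLdef
  have hsa : 0 < √a := Real.sqrt_pos.mpr ha
  have hL : 0 < L := inv_pos.mpr hsa
  have h1 : ENNReal.ofReal (∫ q in (0:ℝ)..L, g q) ≤ ∫⁻ q, ENNReal.ofReal (g q) := by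
    rw [intervalIntegral.integral_of_le hL.le, ofReal_integral_eq_lintegral_ofReal]
    · exact setLIntegral_le_lintegral _ _
    · exact (hgc.integrableOn_Icc).mono_set Set.Ioc_subset_Icc_self
    · exact Filter.Eventually.of_forall hg0
  have h2 : L * ‖p0‖ ^ 2 / 4 ≤ ∫ q in (0:ℝ)..L, ‖p0 + p1 * q‖ ^ 2 := by
    simp_rw [norm_add_mul_sq]
    apply quadratic_integral_lower _ _ _ _ hL (by positivity) (by positivity)
    simp only [← Complex.normSq_eq_norm_sq, Complex.normSq_apply]
    nlinarith [sq_nonneg (p0.re * p1.im - p0.im * p1.re)]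
  have h3 : (∫ q in (0:ℝ)..L, ‖p0 + p1 * q‖ ^ 2) ≤ ∫ q in (0:ℝ)..L, 3 * g q := by
    apply intervalIntegral.integral_mono_on hL.le
    · exact Continuous.intervalIntegrable (by fun_prop) _ _
    · exact Continuous.intervalIntegrable (by fun_prop) _ _
    · intro q hq
      have haq : a * q ^ 2 ≤ 1 := by
        have : q ^ 2 ≤ L ^ 2 := by gcongr; exacts [hq.1, hq.2]
        calc a * q ^ 2 ≤ a * L ^ 2 := by gcongr
          _ = 1 := by
            rw [hLdef, inv_pow, Real.sq_sqrt ha.le, mul_inv_cancel₀ ha.ne']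
      have hbq : b * q ≤ 0 := mul_nonpos_of_nonpos_of_nonneg hb hq.1
      have he : Real.exp (-1) ≤ Real.exp (-(a * q ^ 2 + b * q)) :=
        Real.exp_le_exp.mpr (by linarith)
      have he3 : 1 ≤ 3 * Real.exp (-1) := by
        rw [Real.exp_neg]
        have := Real.exp_one_lt_d9
        have := Real.exp_pos 1
        rw [← div_eq_mul_inv, le_div_iff₀ this]
        linarith
      have : 1 ≤ 3 * Real.exp (-(a * q ^ 2 + b * q)) := by linarith
      calc ‖p0 + p1 * q‖ ^ 2 = ‖p0 + p1 * q‖ ^ 2 * 1 := by ring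
        _ ≤ ‖p0 + p1 * q‖ ^ 2 * (3 * Real.exp (-(a * q ^ 2 + b * q))) := by gcongr
        _ = 3 * g q := by rw [hg]; ring
  rw [intervalIntegral.integral_const_mul] at h3
  have h4 : ‖p0‖ ^ 2 ≤ 12 * √a * ∫ q in (0:ℝ)..L, g q := by
    have h5 : L * ‖p0‖ ^ 2 ≤ 12 * ∫ q in (0:ℝ)..L, g q := by linarith
    have h6 : √a * L = 1 := mul_inv_cancel₀ hsa.ne'
    calc ‖p0‖ ^ 2 = √a * (L * ‖p0‖ ^ 2) := by rw [← mul_assoc, h6, one_mul]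
      _ ≤ √a * (12 * ∫ q in (0:ℝ)..L, g q) := by gcongr
      _ = _ := by ring
  calc ENNReal.ofReal (‖p0‖ ^ 2) ≤ ENNReal.ofReal (12 * √a * ∫ q in (0:ℝ)..L, g q) :=
        ENNReal.ofReal_le_ofReal h4
    _ = ENNReal.ofReal (12 * √a) * ENNReal.ofReal (∫ q in (0:ℝ)..L, g q) :=
        ENNReal.ofReal_mul (by positivity)
    _ ≤ _ := by gcongr

/-- The modulus square of an affine function times a Gaussian is pointwise controlled by its
integral. -/
lemma value_le_lintegral (a b c : ℝ) (ha : 0 < a) (p0 p1 : ℂ) (q0 : ℝ) :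
    ENNReal.ofReal (‖p0 + p1 * q0‖ ^ 2 * Real.exp (-(a * q0 ^ 2 + b * q0 + c))) ≤
      ENNReal.ofReal (12 * √a) *
      ∫⁻ q : ℝ, ENNReal.ofReal (‖p0 + p1 * q‖ ^ 2 * Real.exp (-(a * q ^ 2 + b * q + c))) := by
  have key : ∀ (b : ℝ) (p0 p1 : ℂ), ENNReal.ofReal (‖p0‖ ^ 2) ≤ ENNReal.ofReal (12 * √a) *
      ∫⁻ q : ℝ, ENNReal.ofReal (‖p0 + p1 * q‖ ^ 2 * Real.exp (-(a * q ^ 2 + b * q))) := by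
    intro b p0 p1
    rcases le_total b 0 with hb | hb
    · exact value_zero_le_aux a b ha hb p0 p1
    · have h := value_zero_le_aux a (-b) ha (by linarith) p0 (-p1)
      refine h.trans_eq ?_
      congr 1
      rw [← lintegral_sub_left_eq_self _ (0:ℝ)]
      congr 1
      ext q
      congr 2
      · congr 2; push_cast; ring
      · congr 1; ring
  have h := key (2 * a * q0 + b) (p0 + p1 * q0) p1
  rw [ENNReal.ofReal_mul (by positivity)]
  set e := Real.exp (-(a * q0 ^ 2 + b * q0 + c)) with he
  have h2 : ∫⁻ q : ℝ, ENNReal.ofReal (‖p0 + p1 * q‖ ^ 2 * Real.exp (-(a * q ^ 2 + b * q + c)))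
      = ENNReal.ofReal e * ∫⁻ q : ℝ, ENNReal.ofReal
        (‖p0 + p1 * q0 + p1 * q‖ ^ 2 * Real.exp (-(a * q ^ 2 + (2 * a * q0 + b) * q))) := by
    rw [← lintegral_const_mul' _ _ ENNReal.ofReal_ne_top, ← lintegral_add_left_eq_self _ q0]
    congr 1
    ext q
    rw [← ENNReal.ofReal_mul (by positivity)]
    congr 1
    rw [mul_left_comm, he, ← Real.exp_add]
    congr 2
    · congr 1; push_cast; ring
    · ring
  rw [h2, mul_left_comm, mul_comm]
  gcongr

lemma lintegral_abs_rpow_neg (s δ : ℝ) (hs : s < 1) (hδ : 0 < δ) :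
    ∫⁻ q in Set.Ioo (-δ) δ, ENNReal.ofReal |q| ^ (-s) ≤
      ENNReal.ofReal (2 / (1 - s)) * ENNReal.ofReal δ ^ (1 - s) := by
  have h0 : ∫⁻ q in Set.Ioc 0 δ, ENNReal.ofReal |q| ^ (-s) =
      ENNReal.ofReal (δ ^ (1 - s) / (1 - s)) := by
    have : ∫⁻ q in Set.Ioc 0 δ, ENNReal.ofReal |q| ^ (-s) =
        ∫⁻ q in Set.Ioc 0 δ, ENNReal.ofReal (q ^ (-s)) := by
      apply setLIntegral_congr_fun measurableSet_Ioc
      intro q hq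
      simp only
      rw [abs_of_pos hq.1, ENNReal.ofReal_rpow_of_pos hq.1]
    have hi := intervalIntegral.intervalIntegrable_rpow' (a := 0) (b := δ) (r := -s) (by linarith)
    rw [this, ← ofReal_integral_eq_lintegral_ofReal, ← intervalIntegral.integral_of_le hδ.le,
      integral_rpow (by left; linarith)]
    · rw [Real.zero_rpow (by linarith)]
      congr 1
      rw [show -s + 1 = 1 - s by ring]; ring
    · exact (intervalIntegrable_iff_integrableOn_Ioc_of_le hδ.le).mp hi
    · filter_upwards [ae_restrict_mem measurableSet_Ioc] with q hq
      exact Real.rpow_nonneg hq.1.le _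
  have h1 : ∫⁻ q in Set.Ioo (-δ) 0, ENNReal.ofReal |q| ^ (-s) ≤
      ∫⁻ q in Set.Ioc 0 δ, ENNReal.ofReal |q| ^ (-s) := by
    rw [← lintegral_indicator measurableSet_Ioo, ← lintegral_indicator measurableSet_Ioc,
      ← lintegral_sub_left_eq_self _ (0:ℝ)]
    apply lintegral_mono
    intro q
    simp only [zero_sub]
    by_cases hq : -q ∈ Set.Ioo (-δ) 0
    · have hq' : q ∈ Set.Ioc 0 δ := ⟨by linarith [hq.2], by linarith [hq.1]⟩
      rw [Set.indicator_of_mem hq, Set.indicator_of_mem hq', abs_neg]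
    · rw [Set.indicator_of_notMem hq]; exact zero_le
  have h2 : Set.Ioo (-δ) δ ⊆ Set.Ioo (-δ) 0 ∪ {0} ∪ Set.Ioc 0 δ := by
    intro q hq
    rcases lt_trichotomy q 0 with h | h | h
    · left; left; exact ⟨hq.1, h⟩
    · left; right; exact h
    · right; exact ⟨h, hq.2.le⟩
  calc ∫⁻ q in Set.Ioo (-δ) δ, ENNReal.ofReal |q| ^ (-s)
      ≤ ∫⁻ q in Set.Ioo (-δ) 0 ∪ {0} ∪ Set.Ioc 0 δ, ENNReal.ofReal |q| ^ (-s) :=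
        lintegral_mono_set h2
    _ ≤ (∫⁻ q in Set.Ioo (-δ) 0 ∪ {0}, ENNReal.ofReal |q| ^ (-s)) +
          ∫⁻ q in Set.Ioc 0 δ, ENNReal.ofReal |q| ^ (-s) := lintegral_union_le _ _ _
    _ ≤ ((∫⁻ q in Set.Ioo (-δ) 0, ENNReal.ofReal |q| ^ (-s)) +
          ∫⁻ q in ({0} : Set ℝ), ENNReal.ofReal |q| ^ (-s)) +
          ∫⁻ q in Set.Ioc 0 δ, ENNReal.ofReal |q| ^ (-s) := by
        gcongr; exact lintegral_union_le _ _ _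
    _ ≤ (ENNReal.ofReal (δ ^ (1 - s) / (1 - s)) + 0) + ENNReal.ofReal (δ ^ (1 - s) / (1 - s)) := by
        rw [← h0]
        gcongr
        simp
    _ = _ := by
        have : 0 < 1 - s := by linarith
        rw [add_zero, ← ENNReal.ofReal_add (by positivity) (by positivity),
          ENNReal.ofReal_rpow_of_pos hδ, ← ENNReal.ofReal_mul (by positivity)]
        congr 1; ring

/-- Negative fractional moments of a density of the form `|p0 + p1 q|² exp(-(a q² + b q + c))`. -/
lemma lintegral_rpow_neg_mul_le (s : ℝ) (hs0 : 0 < s) (hs : s < 1) (a b c : ℝ) (ha : 0 < a)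
    (p0 p1 : ℂ) :
    ∫⁻ q : ℝ, ENNReal.ofReal |q| ^ (-s) *
        ENNReal.ofReal (‖p0 + p1 * q‖ ^ 2 * Real.exp (-(a * q ^ 2 + b * q + c))) ≤
      ENNReal.ofReal (24 / (1 - s) + 1) * ENNReal.ofReal a ^ (s / 2) *
      ∫⁻ q : ℝ, ENNReal.ofReal (‖p0 + p1 * q‖ ^ 2 * Real.exp (-(a * q ^ 2 + b * q + c))) := by
  set g : ℝ → ℝ≥0∞ := fun q =>
    ENNReal.ofReal (‖p0 + p1 * q‖ ^ 2 * Real.exp (-(a * q ^ 2 + b * q + c))) with hg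
  have hgm : Measurable g := by fun_prop
  have hsa : 0 < √a := Real.sqrt_pos.mpr ha
  set δ := (√a)⁻¹ with hδdef
  have hδ : 0 < δ := inv_pos.mpr hsa
  have hA := ENNReal.ofReal_pos.mpr ha
  have hδE : ENNReal.ofReal δ = ENNReal.ofReal a ^ (-(1/2) : ℝ) := by
    rw [ENNReal.ofReal_rpow_of_pos ha, hδdef, Real.sqrt_eq_rpow, Real.rpow_neg ha.le]
  have hsaE : ENNReal.ofReal √a = ENNReal.ofReal a ^ (1/2 : ℝ) := by
    rw [ENNReal.ofReal_rpow_of_pos ha, Real.sqrt_eq_rpow]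
  set I := ∫⁻ q, g q
  rw [← lintegral_add_compl _ (measurableSet_Ioo (a := -δ) (b := δ))]
  have h1 : ∫⁻ q in Set.Ioo (-δ) δ, ENNReal.ofReal |q| ^ (-s) * g q ≤
      ENNReal.ofReal (24 / (1 - s)) * ENNReal.ofReal a ^ (s / 2) * I := by
    calc ∫⁻ q in Set.Ioo (-δ) δ, ENNReal.ofReal |q| ^ (-s) * g q
        ≤ ∫⁻ q in Set.Ioo (-δ) δ, ENNReal.ofReal |q| ^ (-s) * (ENNReal.ofReal (12 * √a) * I) := by
          apply lintegral_mono
          intro q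
          dsimp only
          gcongr
          exact value_le_lintegral a b c ha p0 p1 q
      _ = (∫⁻ q in Set.Ioo (-δ) δ, ENNReal.ofReal |q| ^ (-s)) *
            (ENNReal.ofReal (12 * √a) * I) := lintegral_mul_const _ (by fun_prop)
      _ ≤ (ENNReal.ofReal (2 / (1 - s)) * ENNReal.ofReal δ ^ (1 - s)) *
            (ENNReal.ofReal (12 * √a) * I) := by
          gcongr; exact lintegral_abs_rpow_neg s δ hs hδ
      _ = (ENNReal.ofReal (2 / (1 - s)) * ENNReal.ofReal 12) *
            (ENNReal.ofReal a ^ (-(1/2) * (1 - s)) * ENNReal.ofReal a ^ (1/2 : ℝ)) * I := by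
          rw [hδE, ← ENNReal.rpow_mul, ENNReal.ofReal_mul (by norm_num), hsaE]; ring
      _ = _ := by
          rw [← ENNReal.ofReal_mul (by have : 0 < 1 - s := by linarith
                                       positivity),
            ← ENNReal.rpow_add _ _ hA.ne' ENNReal.ofReal_ne_top]
          congr 3
          · ring
          · ring
  have h2 : ∫⁻ q in (Set.Ioo (-δ) δ)ᶜ, ENNReal.ofReal |q| ^ (-s) * g q ≤
      ENNReal.ofReal a ^ (s / 2) * I := by
    calc ∫⁻ q in (Set.Ioo (-δ) δ)ᶜ, ENNReal.ofReal |q| ^ (-s) * g q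
        ≤ ∫⁻ q in (Set.Ioo (-δ) δ)ᶜ, ENNReal.ofReal δ ^ (-s) * g q := by
          apply setLIntegral_mono' measurableSet_Ioo.compl
          intro q hq
          have hq' : δ ≤ |q| := by
            by_contra h
            exact hq (abs_lt.mp (not_le.mp h))
          gcongr ?_ * _
          rw [ENNReal.rpow_neg, ENNReal.rpow_neg]
          gcongr
      _ ≤ ∫⁻ q, ENNReal.ofReal δ ^ (-s) * g q := setLIntegral_le_lintegral _ _
      _ = ENNReal.ofReal δ ^ (-s) * I := lintegral_const_mul _ hgm
      _ = _ := by
          rw [hδE, ← ENNReal.rpow_mul]; congr 2; ring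
  calc _ ≤ _ := add_le_add h1 h2
    _ = _ := by
      rw [ENNReal.ofReal_add (by have : 0 < 1 - s := by linarith
                                 positivity) (by norm_num)]
      simp; ring

/-- The sign attached to a Boolean. -/
def boolSign (b : Bool) : ℂ := if b then 1 else -1

lemma norm_boolSign (b : Bool) : ‖boolSign b‖ = 1 := by cases b <;> simp [boolSign]

section Signs

variable {E : Type*} [NormedAddCommGroup E] [InnerProductSpace ℂ E]

lemma norm_add_sq_add_norm_sub_sq (x y : E) :
    ‖x + y‖ ^ 2 + ‖x - y‖ ^ 2 = 2 * (‖x‖ ^ 2 + ‖y‖ ^ 2) := by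
  rw [@norm_add_sq ℂ, @norm_sub_sq ℂ]; ring

lemma norm_add_pow_four_add_norm_sub_pow_four_le (x y : E) :
    ‖x + y‖ ^ 4 + ‖x - y‖ ^ 4 ≤ 2 * (‖x‖ ^ 4 + 6 * ‖x‖ ^ 2 * ‖y‖ ^ 2 + ‖y‖ ^ 4) := by
  have h1 : ‖x + y‖ ^ 4 = (‖x + y‖ ^ 2) ^ 2 := by ring
  have h2 : ‖x - y‖ ^ 4 = (‖x - y‖ ^ 2) ^ 2 := by ring
  rw [h1, h2, @norm_add_sq ℂ, @norm_sub_sq ℂ]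
  have h3 : (RCLike.re (inner ℂ x y)) ^ 2 ≤ (‖x‖ * ‖y‖) ^ 2 := by
    rw [← sq_abs]
    gcongr
    exact (RCLike.abs_re_le_norm _).trans (norm_inner_le_norm x y)
  nlinarith

lemma sum_bool_fun_succ {M : Type*} [AddCommMonoid M] {N : ℕ} (F : (Fin (N + 1) → Bool) → M) :
    ∑ ε, F ε = ∑ ε : Fin N → Bool, (F (Fin.cons true ε) + F (Fin.cons false ε)) := by
  rw [← (Fin.consEquiv (fun _ : Fin (N + 1) => Bool)).sum_comp, Fintype.sum_prod_type]
  simp only [Fintype.sum_bool, Finset.sum_add_distrib]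
  rfl

lemma sum_boolSign_smul_cons {N : ℕ} (g : Fin (N + 1) → E) (b : Bool) (ε : Fin N → Bool) :
    ∑ i, boolSign (Fin.cons (α := fun _ => Bool) b ε i) • g i =
      boolSign b • g 0 + ∑ i, boolSign (ε i) • g i.succ := by
  rw [Fin.sum_univ_succ]; simp

lemma sum_norm_sq_signs : ∀ {N : ℕ} (g : Fin N → E),
    ∑ ε : Fin N → Bool, ‖∑ i, boolSign (ε i) • g i‖ ^ 2 = 2 ^ N * ∑ i, ‖g i‖ ^ 2
  | 0, g => by simp
  | N + 1, g => by
    rw [sum_bool_fun_succ]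
    have h : ∀ ε : Fin N → Bool,
        ‖∑ i, boolSign (Fin.cons (α := fun _ => Bool) true ε i) • g i‖ ^ 2 +
        ‖∑ i, boolSign (Fin.cons (α := fun _ => Bool) false ε i) • g i‖ ^ 2 =
        2 * (‖∑ i, boolSign (ε i) • g i.succ‖ ^ 2 + ‖g 0‖ ^ 2) := by
      intro ε
      rw [sum_boolSign_smul_cons, sum_boolSign_smul_cons, ← norm_add_sq_add_norm_sub_sq]
      simp only [boolSign]
      congr 3
      · simp [add_comm]
      · simp; abel
    simp_rw [h, ← Finset.mul_sum, Finset.sum_add_distrib,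
      sum_norm_sq_signs (fun i : Fin N => g i.succ), Fin.sum_univ_succ (fun i => ‖g i‖ ^ 2)]
    simp
    ring

lemma sum_norm_pow_four_signs_le : ∀ {N : ℕ} (g : Fin N → E),
    ∑ ε : Fin N → Bool, ‖∑ i, boolSign (ε i) • g i‖ ^ 4 ≤ 3 * 2 ^ N * (∑ i, ‖g i‖ ^ 2) ^ 2
  | 0, g => by simp
  | N + 1, g => by
    rw [sum_bool_fun_succ]
    have h : ∀ ε : Fin N → Bool,
        ‖∑ i, boolSign (Fin.cons (α := fun _ => Bool) true ε i) • g i‖ ^ 4 +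
        ‖∑ i, boolSign (Fin.cons (α := fun _ => Bool) false ε i) • g i‖ ^ 4 ≤
        2 * (‖∑ i, boolSign (ε i) • g i.succ‖ ^ 4 +
          6 * ‖∑ i, boolSign (ε i) • g i.succ‖ ^ 2 * ‖g 0‖ ^ 2 + ‖g 0‖ ^ 4) := by
      intro ε
      rw [sum_boolSign_smul_cons, sum_boolSign_smul_cons]
      refine le_of_eq_of_le ?_ (norm_add_pow_four_add_norm_sub_pow_four_le _ _)
      simp only [boolSign]
      congr 3
      · simp [add_comm]
      · simp; abel
    refine (Finset.sum_le_sum fun ε _ => h ε).trans ?_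
    have ih := sum_norm_pow_four_signs_le (fun i : Fin N => g i.succ)
    have h2 := sum_norm_sq_signs (fun i : Fin N => g i.succ)
    simp_rw [← Finset.mul_sum, Finset.sum_add_distrib, ← Finset.sum_mul, ← Finset.mul_sum, h2,
      Fin.sum_univ_succ (fun i => ‖g i‖ ^ 2)]
    simp only [Finset.sum_const, Finset.card_univ, Fintype.card_fun, Fintype.card_bool,
      Fintype.card_fin, nsmul_eq_mul, Nat.cast_pow, Nat.cast_ofNat]
    set S := ∑ i : Fin N, ‖g i.succ‖ ^ 2
    have hp : (0:ℝ) < 2 ^ N := by positivity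
    have h4 : ‖g 0‖ ^ 4 = (‖g 0‖ ^ 2) ^ 2 := by ring
    have := mul_nonneg hp.le (sq_nonneg (‖g 0‖ ^ 2))
    rw [h4, pow_succ (2:ℝ) N]
    nlinarith

/-- Lower bound in Khinchin's inequality for exponents in `(0, 1)`. -/
lemma khinchin_lower {N : ℕ} (s : ℝ) (hs0 : 0 < s) (hs1 : s < 1) (g : Fin N → E) :
    2 ^ N * (∑ i, ‖g i‖ ^ 2) ^ (s / 2) ≤
      12 * ∑ ε : Fin N → Bool, ‖∑ i, boolSign (ε i) • g i‖ ^ s := by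
  have h2 := sum_norm_sq_signs g
  have h4 := sum_norm_pow_four_signs_le g
  set F := ∑ i, ‖g i‖ ^ 2
  have hF : 0 ≤ F := by positivity
  rcases hF.eq_or_lt with hF | hF
  · rw [← hF, Real.zero_rpow (by positivity), mul_zero]
    positivity
  have hpt : ∀ x : ℝ, 0 ≤ x → x ^ 2 ≤ (6 * F) ^ (1 - s / 2) * x ^ s + x ^ 4 / (6 * F) := by
    intro x hx
    rcases le_total (x ^ 2) (6 * F) with h | h
    · have h1 : x ^ 2 = (x ^ 2) ^ (1 - s / 2) * x ^ s := by
        rcases hx.eq_or_lt with hx | hx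
        · subst hx; simp [hs0.ne']
        · rw [← Real.rpow_natCast x 2, ← Real.rpow_mul hx.le, ← Real.rpow_add hx]
          congr 1; push_cast; ring
      calc x ^ 2 = (x ^ 2) ^ (1 - s / 2) * x ^ s := h1
        _ ≤ (6 * F) ^ (1 - s / 2) * x ^ s := by
          gcongr; linarith
        _ ≤ _ := by linarith [show 0 ≤ x ^ 4 / (6 * F) by positivity]
    · have h1 : x ^ 2 ≤ x ^ 4 / (6 * F) := by
        rw [le_div_iff₀ (by positivity)]
        nlinarith [sq_nonneg x]
      linarith [show 0 ≤ (6 * F) ^ (1 - s / 2) * x ^ s by positivity]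
  have hsum := Finset.sum_le_sum fun (ε : Fin N → Bool) (_ : ε ∈ Finset.univ) =>
    hpt ‖∑ i, boolSign (ε i) • g i‖ (norm_nonneg _)
  rw [h2, Finset.sum_add_distrib, ← Finset.mul_sum, ← Finset.sum_div] at hsum
  set X := ∑ ε : Fin N → Bool, ‖∑ i, boolSign (ε i) • g i‖ ^ s
  have hX : 0 ≤ X := by positivity
  have h5 : (∑ ε : Fin N → Bool, ‖∑ i, boolSign (ε i) • g i‖ ^ 4) / (6 * F) ≤ 2 ^ N * F / 2 := by
    rw [div_le_iff₀ (by positivity)]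
    nlinarith
  have h6 : 2 ^ N * F / 2 ≤ 6 * F ^ (1 - s / 2) * X := by
    have : (6 * F) ^ (1 - s / 2) ≤ 6 * F ^ (1 - s / 2) := by
      rw [Real.mul_rpow (by norm_num) hF.le]
      gcongr
      calc (6:ℝ) ^ (1 - s / 2) ≤ 6 ^ (1:ℝ) :=
            Real.rpow_le_rpow_of_exponent_le (by norm_num) (by linarith)
        _ = 6 := Real.rpow_one _
    have := mul_le_mul_of_nonneg_right this hX
    linarith
  have h7 : F = F ^ (1 - s / 2) * F ^ (s / 2) := by
    rw [← Real.rpow_add hF]; simp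
  have hpos : 0 < F ^ (1 - s / 2) := Real.rpow_pos_of_pos hF _
  refine le_of_mul_le_mul_left ?_ hpos
  calc F ^ (1 - s / 2) * (2 ^ N * F ^ (s / 2)) = 2 ^ N * (F ^ (1 - s / 2) * F ^ (s / 2)) := by ring
    _ = 2 ^ N * F := by rw [← h7]
    _ ≤ _ := by linarith

end Signs

lemma opNorm_le_frobenius {N : ℕ} (M : Mat N) :
    opNorm M ≤ √(∑ j, ‖WithLp.toLp 2 (M.col j)‖ ^ 2) := by
  refine ContinuousLinearMap.opNorm_le_bound _ (Real.sqrt_nonneg _) fun x => ?_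
  have h1 : Matrix.toEuclideanCLM (𝕜 := ℂ) M x = ∑ j, x j • WithLp.toLp 2 (M.col j) := by
    ext i
    simp [Matrix.mulVec, dotProduct, mul_comm]
  rw [h1]
  calc ‖∑ j, x j • WithLp.toLp 2 (M.col j)‖
      ≤ ∑ j, ‖x j • WithLp.toLp 2 (M.col j)‖ := norm_sum_le _ _
    _ = ∑ j, ‖WithLp.toLp 2 (M.col j)‖ * ‖x j‖ := by simp_rw [norm_smul, mul_comm]
    _ ≤ √(∑ j, ‖WithLp.toLp 2 (M.col j)‖ ^ 2) * √(∑ j, ‖x j‖ ^ 2) :=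
        Real.sum_mul_le_sqrt_mul_sqrt _ _ _
    _ = _ := by rw [EuclideanSpace.norm_eq x]

/-- The operator norm is controlled by the average action on sign vectors. -/
lemma opNorm_rpow_le_sum_signs {N : ℕ} (s : ℝ) (hs0 : 0 < s) (hs1 : s < 1) (M : Mat N) :
    2 ^ N * opNorm M ^ s ≤
      12 * ∑ ε : Fin N → Bool, ‖WithLp.toLp 2 (M *ᵥ fun i => boolSign (ε i))‖ ^ s := by
  have h := khinchin_lower s hs0 hs1 (fun j => WithLp.toLp 2 (M.col j))
  have h1 : ∀ ε : Fin N → Bool, WithLp.toLp 2 (M *ᵥ fun i => boolSign (ε i)) =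
      ∑ i, boolSign (ε i) • WithLp.toLp 2 (M.col i) := by
    intro ε
    ext i
    simp [Matrix.mulVec, dotProduct, mul_comm]
  simp_rw [h1]
  refine le_trans ?_ h
  gcongr
  calc opNorm M ^ s ≤ (√(∑ j, ‖WithLp.toLp 2 (M.col j)‖ ^ 2)) ^ s := by
        gcongr
        · exact norm_nonneg _
        · exact opNorm_le_frobenius M
    _ = _ := by
        rw [Real.sqrt_eq_rpow, ← Real.rpow_mul (by positivity)]
        congr 1; ring

/-- The quadratic form of `M` has nonvanishing imaginary part away from the origin. -/
def ImNeZero {ι : Type*} [Fintype ι] (M : Matrix ι ι ℂ) : Prop :=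
  ∀ x : ι → ℂ, x ≠ 0 → (star x ⬝ᵥ (M *ᵥ x)).im ≠ 0

section ImNeZero

variable {ι κ : Type*} [Fintype ι] [Fintype κ]

lemma im_star_dotProduct_mulVec_of_isHermitian {V : Matrix ι ι ℂ} (hV : V.IsHermitian)
    (x : ι → ℂ) : (star x ⬝ᵥ (V *ᵥ x)).im = 0 :=
  hV.im_star_dotProduct_mulVec_self x

lemma star_mulVec_dotProduct (P : Matrix ι κ ℂ) (x : κ → ℂ) (y : ι → ℂ) :
    star (P *ᵥ x) ⬝ᵥ y = star x ⬝ᵥ (Pᴴ *ᵥ y) := by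
  rw [star_mulVec, dotProduct_mulVec]

lemma im_star_dotProduct_comm (x y : ι → ℂ) : (star x ⬝ᵥ y).im = -(star y ⬝ᵥ x).im := by
  rw [← Complex.conj_im, ← Complex.star_def, star_dotProduct]

namespace ImNeZero

lemma conj {M : Matrix ι ι ℂ} (hM : ImNeZero M) {P : Matrix ι κ ℂ}
    (hP : ∀ x, x ≠ 0 → P *ᵥ x ≠ 0) : ImNeZero (Pᴴ * M * P) := by
  intro x hx
  have := hM _ (hP x hx)
  rwa [star_mulVec_dotProduct, mulVec_mulVec, mulVec_mulVec] at this

lemma hermitian_add {M V : Matrix ι ι ℂ} (hM : ImNeZero M) (hV : V.IsHermitian) :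
    ImNeZero (V + M) := by
  intro x hx
  rw [add_mulVec, dotProduct_add, Complex.add_im, im_star_dotProduct_mulVec_of_isHermitian hV,
    zero_add]
  exact hM x hx

variable [DecidableEq ι] [DecidableEq κ]

lemma isUnit_det {M : Matrix ι ι ℂ} (hM : ImNeZero M) : IsUnit M.det := by
  rw [isUnit_iff_ne_zero]
  intro h
  obtain ⟨v, hv, hv0⟩ := Matrix.exists_mulVec_eq_zero_iff.mpr h
  exact hM v hv (by simp [hv0])

lemma inv {M : Matrix ι ι ℂ} (hM : ImNeZero M) : ImNeZero M⁻¹ := by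
  intro x hx
  have h1 : M *ᵥ (M⁻¹ *ᵥ x) = x := by
    rw [mulVec_mulVec, mul_nonsing_inv _ hM.isUnit_det, one_mulVec]
  have hy : M⁻¹ *ᵥ x ≠ 0 := by
    intro h; rw [h, mulVec_zero] at h1; exact hx h1.symm
  have := hM _ hy
  rw [h1, im_star_dotProduct_comm] at this
  simpa using this

/-- Compression of the resolvent of a perturbation supported on the range of an isometry. -/
lemma compress_inv_add {L : Matrix ι ι ℂ} (hL : ImNeZero L) {P : Matrix ι κ ℂ}
    (hP : Pᴴ * P = 1) {V : Matrix κ κ ℂ} (hV : V.IsHermitian) :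
    Pᴴ * (P * V * Pᴴ + L)⁻¹ * P = (V + (Pᴴ * L⁻¹ * P)⁻¹)⁻¹ := by
  have hPinj : ∀ x, x ≠ 0 → P *ᵥ x ≠ 0 := by
    intro x hx h
    apply hx
    rw [← one_mulVec x, ← hP, ← mulVec_mulVec, h, mulVec_zero]
  have hPV : (P * V * Pᴴ).IsHermitian := isHermitian_mul_mul_conjTranspose P hV
  have hL2 := hL.hermitian_add hPV
  set L2 := P * V * Pᴴ + L with hL2def
  have hS0 := hL.inv.conj hPinj
  set S0 := Pᴴ * L⁻¹ * P with hS0def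
  set S := Pᴴ * L2⁻¹ * P with hSdef
  have hres : L⁻¹ = L2⁻¹ + L⁻¹ * (P * V * Pᴴ) * L2⁻¹ := by
    have h1 : P * V * Pᴴ = L2 - L := by rw [hL2def, add_sub_cancel_right]
    rw [h1, Matrix.mul_sub, Matrix.sub_mul, nonsing_inv_mul _ hL.isUnit_det, Matrix.mul_assoc,
      mul_nonsing_inv _ hL2.isUnit_det, Matrix.mul_one, Matrix.one_mul]
    abel
  have h2 : S0 = S + S0 * V * S := by
    calc S0 = Pᴴ * (L2⁻¹ + L⁻¹ * (P * V * Pᴴ) * L2⁻¹) * P := by rw [hS0def, ← hres]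
      _ = S + S0 * V * S := by
        rw [hS0def, hSdef]
        simp only [Matrix.mul_add, Matrix.add_mul, Matrix.mul_assoc]
  have h3 : (V + S0⁻¹) * S = 1 := by
    have h4 : S0 * ((V + S0⁻¹) * S) = S0 * 1 := by
      rw [← Matrix.mul_assoc, Matrix.mul_add, mul_nonsing_inv _ hS0.isUnit_det, Matrix.add_mul,
        Matrix.one_mul, Matrix.mul_one, add_comm, ← h2]
    calc (V + S0⁻¹) * S = S0⁻¹ * (S0 * ((V + S0⁻¹) * S)) := by
          rw [← Matrix.mul_assoc S0⁻¹, nonsing_inv_mul _ hS0.isUnit_det, Matrix.one_mul]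
      _ = 1 := by rw [h4, Matrix.mul_one, nonsing_inv_mul _ hS0.isUnit_det]
  exact (inv_eq_right_inv h3).symm

end ImNeZero

variable [DecidableEq ι]

lemma continuous_inv_of_imNeZero {X : Type*} [TopologicalSpace X] {M : X → Matrix ι ι ℂ}
    (hM : Continuous M) (h : ∀ x, ImNeZero (M x)) : Continuous fun x => (M x)⁻¹ := by
  have : (fun x => (M x)⁻¹) = fun x => (M x).det⁻¹ • (M x).adjugate := by
    ext1 x
    rw [inv_def, Ring.inverse_eq_inv']
  rw [this]
  exact (hM.matrix_det.inv₀ fun x => (h x).isUnit_det.ne_zero).smul hM.matrix_adjugate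

end ImNeZero

section HermParam

variable {W : ℕ}

lemma toHerm_isHermitian (x : HermParam W) : (toHerm x).IsHermitian := by
  ext i j
  simp only [conjTranspose_apply, toHerm, of_apply]
  rcases lt_trichotomy i j with h | h | h
  · simp [h.ne, h.ne', h, h.not_gt]
  · subst h; simp
  · simp [h.ne, h.ne', h, h.not_gt]

/-- The parameters of a Hermitian matrix. -/
def fromHerm (M : Mat W) : HermParam W := (fun i => (M i i).re, fun p => M p.1.1 p.1.2)

lemma toHerm_fromHerm {M : Mat W} (hM : M.IsHermitian) : toHerm (fromHerm M) = M := by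
  ext i j
  simp only [toHerm, fromHerm, of_apply]
  rcases lt_trichotomy i j with h | h | h
  · simp [h.ne, h]
  · subst h
    simpa using hM.coe_re_apply_self i
  · simpa [h.ne', h, h.not_gt] using hM.apply i j

lemma fromHerm_toHerm (x : HermParam W) : fromHerm (toHerm x) = x := by
  ext p
  · simp [fromHerm, toHerm]
  · have := p.2
    simp [fromHerm, toHerm, this, this.ne]

lemma fromHerm_add (M N : Mat W) : fromHerm (M + N) = fromHerm M + fromHerm N := by
  ext <;> simp [fromHerm]

lemma fromHerm_smul (c : ℝ) (M : Mat W) : fromHerm (c • M) = c • fromHerm M := by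
  ext <;> simp [fromHerm]

lemma toHerm_add (x y : HermParam W) : toHerm (x + y) = toHerm x + toHerm y := by
  rw [← toHerm_fromHerm ((toHerm_isHermitian x).add (toHerm_isHermitian y)), fromHerm_add,
    fromHerm_toHerm, fromHerm_toHerm]

lemma toHerm_smul (c : ℝ) (x : HermParam W) : toHerm (c • x) = c • toHerm x := by
  have h : (c • toHerm x).IsHermitian := by
    rw [IsHermitian, conjTranspose_smul, toHerm_isHermitian x]; simp
  rw [← toHerm_fromHerm h, fromHerm_smul, fromHerm_toHerm]

lemma continuous_toHerm : Continuous (toHerm : HermParam W → Mat W) := by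
  refine continuous_matrix fun i j => ?_
  simp only [toHerm, of_apply]
  split_ifs <;> fun_prop

instance (W : ℕ) : (volume : Measure (HermParam W)).IsAddHaarMeasure :=
  Measure.prod.instIsAddHaarMeasure (volume : Measure (Fin W → ℝ))
    (volume : Measure ({ p : Fin W × Fin W // p.1 < p.2 } → ℂ))

end HermParam

section BlockParam

variable {m : ℕ}

instance (m : ℕ) : (volume : Measure (HermParam m × (Fin m → ℂ) × ℝ)).IsAddHaarMeasure :=
  haveI : ((volume : Measure (Fin m → ℂ)).prod (volume : Measure ℝ)).IsAddHaarMeasure :=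
    Measure.prod.instIsAddHaarMeasure _ _
  Measure.prod.instIsAddHaarMeasure (volume : Measure (HermParam m))
    ((volume : Measure (Fin m → ℂ)).prod (volume : Measure ℝ))

/-- Hermitian matrices of size `m + 1` written in blocks of sizes `1` and `m`. -/
def blockHerm (p : HermParam m × (Fin m → ℂ) × ℝ) : Matrix (Unit ⊕ Fin m) (Unit ⊕ Fin m) ℂ :=
  fromBlocks (of fun _ _ => (p.2.2 : ℂ)) (of fun _ j => star (p.2.1 j))
    (of fun i _ => p.2.1 i) (toHerm p.1)

lemma blockHerm_isHermitian (p : HermParam m × (Fin m → ℂ) × ℝ) :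
    (blockHerm p).IsHermitian := by
  refine IsHermitian.fromBlocks ?_ ?_ (toHerm_isHermitian _)
  · ext; simp
  · ext; simp

lemma continuous_blockHerm : Continuous (blockHerm (m := m)) := by
  refine Continuous.matrix_fromBlocks ?_ ?_ ?_ (continuous_toHerm.comp continuous_fst)
  all_goals refine continuous_matrix fun i j => ?_
  all_goals simp only [of_apply]; fun_prop

/-- The Gaussian weight in block coordinates. -/
def blockWeight (w : ℝ) (p : HermParam m × (Fin m → ℂ) × ℝ) : ℝ≥0∞ :=
  ENNReal.ofReal (Real.exp (-w * (p.2.2 ^ 2 + 2 * ∑ i, ‖p.2.1 i‖ ^ 2 +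
    (trace (toHerm p.1 * toHerm p.1)).re)))

lemma measurable_blockWeight (w : ℝ) : Measurable (blockWeight (m := m) w) := by
  have : Continuous fun p : HermParam m × (Fin m → ℂ) × ℝ =>
      (trace (toHerm p.1 * toHerm p.1)).re :=
    Complex.continuous_re.comp
      (((continuous_toHerm.comp continuous_fst).matrix_mul
        (continuous_toHerm.comp continuous_fst)).matrix_trace)
  unfold blockWeight
  apply ENNReal.measurable_ofReal.comp
  apply Continuous.measurable
  fun_prop

lemma lintegral_eq_norm_det_sq_mul (A : Mat m) (hA : A.det ≠ 0)
    (f : (Fin m → ℂ) → ℝ≥0∞) (hf : Measurable f) :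
    ∫⁻ b, f b = ENNReal.ofReal (‖A.det‖ ^ 2) * ∫⁻ y, f (A *ᵥ y) := by
  set T : (Fin m → ℂ) →ₗ[ℝ] (Fin m → ℂ) := (Matrix.toLin' A).restrictScalars ℝ with hT
  have hdet : LinearMap.det T = ‖A.det‖ ^ 2 := by
    rw [hT, LinearMap.det_restrictScalars, LinearMap.det_toLin', Algebra.norm_complex_eq,
      ← Complex.normSq_eq_norm_sq]
    rfl
  have hpos : 0 < ‖A.det‖ ^ 2 := by positivity
  have hmap := Measure.map_linearMap_addHaar_eq_smul_addHaar
    (volume : Measure (Fin m → ℂ)) (f := T) (by rw [hdet]; exact hpos.ne')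
  have hTm : Measurable T := (LinearMap.continuous_of_finiteDimensional T).measurable
  have h1 : ∫⁻ y, f (A *ᵥ y) = ∫⁻ b, f b ∂(Measure.map T volume) := by
    rw [lintegral_map hf hTm]
    rfl
  rw [h1, hmap, lintegral_smul_measure, smul_eq_mul, ← mul_assoc, hdet,
    abs_of_pos (inv_pos.mpr hpos), ← ENNReal.ofReal_mul hpos.le, mul_inv_cancel₀ hpos.ne']
  simp

lemma lintegral_prod_triple {α β γ : Type*} [MeasureSpace α] [MeasureSpace β] [MeasureSpace γ]
    [SFinite (volume : Measure α)] [SFinite (volume : Measure β)]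
    [SFinite (volume : Measure γ)] (F : α × β × γ → ℝ≥0∞) (hF : Measurable F) :
    ∫⁻ p, F p = ∫⁻ x, ∫⁻ y, ∫⁻ z, F (x, y, z) := by
  rw [Measure.volume_eq_prod, lintegral_prod _ hF.aemeasurable]
  congr 1
  ext x
  rw [Measure.volume_eq_prod, lintegral_prod]
  exact (hF.comp (by fun_prop)).aemeasurable

/-- The off-diagonal column expressed through the lower block and the direction `y`. -/
def columnOf (Z : Matrix (Unit ⊕ Fin m) (Unit ⊕ Fin m) ℂ) (D : HermParam m) (y : Fin m → ℂ) :
    Fin m → ℂ :=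
  -((toHerm D + Z.toBlocks₂₂) *ᵥ y + fun i => Z (Sum.inr i) (Sum.inl ()))

/-- The shift relating the corner entry to the inverse of the corner of the resolvent. -/
def cornerShift (Z : Matrix (Unit ⊕ Fin m) (Unit ⊕ Fin m) ℂ) (D : HermParam m)
    (y : Fin m → ℂ) : ℝ :=
  (Z (Sum.inl ()) (Sum.inl ()) +
    ∑ i, (star (columnOf Z D y i) + Z (Sum.inl ()) (Sum.inr i)) * y i).re

/-- The rank one Hermitian matrix `y y*`. -/
def rankOne (y : Fin m → ℂ) : HermParam m := fromHerm (vecMulVec y (star y))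

lemma toHerm_rankOne (y : Fin m → ℂ) : toHerm (rankOne y) = vecMulVec y (star y) :=
  toHerm_fromHerm (by ext i j; simp [vecMulVec_apply, mul_comm])

lemma continuous_columnOf (Z : Matrix (Unit ⊕ Fin m) (Unit ⊕ Fin m) ℂ) :
    Continuous fun p : HermParam m × (Fin m → ℂ) => columnOf Z p.1 p.2 := by
  unfold columnOf
  refine Continuous.neg (Continuous.add ?_ continuous_const)
  exact ((continuous_toHerm.comp continuous_fst).add continuous_const).matrix_mulVec continuous_snd

lemma continuous_cornerShift (Z : Matrix (Unit ⊕ Fin m) (Unit ⊕ Fin m) ℂ) :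
    Continuous fun p : HermParam m × (Fin m → ℂ) => cornerShift Z p.1 p.2 := by
  have := continuous_columnOf Z
  unfold cornerShift
  fun_prop

lemma imNeZero_toBlocks₂₂ {Z : Matrix (Unit ⊕ Fin m) (Unit ⊕ Fin m) ℂ} (hZ : ImNeZero Z) :
    ImNeZero Z.toBlocks₂₂ := by
  intro x hx
  have h := hZ (Sum.elim 0 x) (by
    intro h; apply hx; ext i; exact congrFun h (Sum.inr i))
  simpa [dotProduct, mulVec, Fintype.sum_sum_type, toBlocks₂₂] using h

/-- Change of variables from the matrix entries to the lower block, the direction of the first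
column of the resolvent and the inverse of its first entry. -/
lemma lintegral_block_eq {Z : Matrix (Unit ⊕ Fin m) (Unit ⊕ Fin m) ℂ} (hZ : ImNeZero Z)
    (F : HermParam m × (Fin m → ℂ) × ℝ → ℝ≥0∞) (hF : Measurable F) (c : (Fin m → ℂ) → ℝ) :
    ∫⁻ p, F p = ∫⁻ y, ∫⁻ D, ∫⁻ q : ℝ,
      ENNReal.ofReal (‖(toHerm (D + (q * c y) • rankOne y) + Z.toBlocks₂₂).det‖ ^ 2) *
      F (D + (q * c y) • rankOne y, columnOf Z (D + (q * c y) • rankOne y) y,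
        q - cornerShift Z (D + (q * c y) • rankOne y) y) := by
  have hcol := continuous_columnOf Z
  have hcor := continuous_cornerShift Z
  have hdetc : Continuous fun D : HermParam m => ‖(toHerm D + Z.toBlocks₂₂).det‖ ^ 2 :=
    ((continuous_toHerm.add continuous_const).matrix_det).norm.pow 2
  set Φ : HermParam m → (Fin m → ℂ) → ℝ → ℝ≥0∞ := fun D y q =>
    ENNReal.ofReal (‖(toHerm D + Z.toBlocks₂₂).det‖ ^ 2) *
      F (D, columnOf Z D y, q - cornerShift Z D y) with hΦ
  have hΦm : Measurable fun p : (HermParam m × (Fin m → ℂ)) × ℝ => Φ p.1.1 p.1.2 p.2 := by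
    apply Measurable.mul
    · exact ENNReal.measurable_ofReal.comp (hdetc.measurable.comp (by fun_prop))
    · apply hF.comp
      have h1 := hcol.measurable
      have h2 := hcor.measurable
      fun_prop
  have hstep : ∀ D : HermParam m, ∫⁻ b, ∫⁻ a, F (D, b, a) = ∫⁻ y, ∫⁻ q, Φ D y q := by
    intro D
    have hD : (-(toHerm D + Z.toBlocks₂₂)).det ≠ 0 := by
      have := ((imNeZero_toBlocks₂₂ hZ).hermitian_add (toHerm_isHermitian D)).isUnit_det.ne_zero
      rw [det_neg]
      exact mul_ne_zero (by simp) this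
    have hnorm : ‖(-(toHerm D + Z.toBlocks₂₂)).det‖ = ‖(toHerm D + Z.toBlocks₂₂).det‖ := by
      rw [det_neg]; simp
    rw [← lintegral_sub_right_eq_self _ (fun i => Z (Sum.inr i) (Sum.inl ())),
      lintegral_eq_norm_det_sq_mul _ hD, hnorm, ← lintegral_const_mul]
    · congr 1
      ext y
      rw [← lintegral_const_mul, ← lintegral_sub_right_eq_self _ (cornerShift Z D y)]
      · simp only [hΦ]
        congr 1
        ext q
        have : -(toHerm D + Z.toBlocks₂₂) *ᵥ y - (fun i => Z (Sum.inr i) (Sum.inl ())) =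
            columnOf Z D y := by
          rw [columnOf, neg_mulVec]; abel
        rw [this]
      · exact hF.comp (by fun_prop)
    · apply Measurable.lintegral_prod_right' (f := fun p : (Fin m → ℂ) × ℝ =>
        F (D, -(toHerm D + Z.toBlocks₂₂) *ᵥ p.1 - (fun i => Z (Sum.inr i) (Sum.inl ())), p.2))
      apply hF.comp
      have : Measurable fun p : (Fin m → ℂ) × ℝ => -(toHerm D + Z.toBlocks₂₂) *ᵥ p.1 :=
        (Continuous.matrix_mulVec continuous_const continuous_fst).measurable
      fun_prop
    · apply Measurable.lintegral_prod_right' (f := fun p : (Fin m → ℂ) × ℝ =>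
        F (D, p.1 - (fun i => Z (Sum.inr i) (Sum.inl ())), p.2))
      exact hF.comp (by fun_prop)
  rw [lintegral_prod_triple F hF]
  simp_rw [hstep]
  rw [lintegral_lintegral_swap]
  · congr 1
    ext y
    have hy : Measurable fun p : HermParam m × ℝ => Φ p.1 y p.2 :=
      hΦm.comp (f := fun p : HermParam m × ℝ => ((p.1, y), p.2)) (by fun_prop)
    rw [lintegral_lintegral_swap hy.aemeasurable]
    have : ∀ q : ℝ, ∫⁻ D, Φ D y q = ∫⁻ D, Φ (D + (q * c y) • rankOne y) y q := fun q =>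
      (lintegral_add_right_eq_self (fun D => Φ D y q) ((q * c y) • rankOne y)).symm
    simp_rw [this]
    rw [lintegral_lintegral_swap]
    exact (hy.comp (f := fun p : ℝ × HermParam m => (p.2 + (p.1 * c y) • rankOne y, p.1))
      (by fun_prop)).aemeasurable
  · exact (hΦm.lintegral_prod_right').aemeasurable

end BlockParam

section BlockBound

variable {m : ℕ}

/-- The first basis vector in block coordinates. -/
def blockBasis (m : ℕ) : Unit ⊕ Fin m → ℂ := Sum.elim 1 0

lemma blockHerm_add_mulVec (Z : Matrix (Unit ⊕ Fin m) (Unit ⊕ Fin m) ℂ) (D : HermParam m)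
    (y : Fin m → ℂ) (q : ℝ) : ∃ k : ℂ, k.re = q ∧
    (blockHerm (D, columnOf Z D y, q - cornerShift Z D y) + Z) *ᵥ Sum.elim 1 y =
      k • blockBasis m := by
  refine ⟨((q - cornerShift Z D y : ℝ) : ℂ) + (Z (Sum.inl ()) (Sum.inl ()) +
    ∑ i, (star (columnOf Z D y i) + Z (Sum.inl ()) (Sum.inr i)) * y i), ?_, ?_⟩
  · rw [Complex.add_re, Complex.ofReal_re]
    unfold cornerShift
    ring
  · ext i
    rcases i with i | i
    · simp [blockHerm, blockBasis, mulVec, dotProduct, Fintype.sum_sum_type]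
      ring
    · simp [blockHerm, blockBasis, mulVec, dotProduct, Fintype.sum_sum_type, columnOf,
        toBlocks₂₂]

lemma norm_blockInv_mulVec_rpow_le {Z : Matrix (Unit ⊕ Fin m) (Unit ⊕ Fin m) ℂ} (hZ : ImNeZero Z)
    (D : HermParam m) (y : Fin m → ℂ) (q : ℝ) {s : ℝ} (hs : 0 < s) :
    ENNReal.ofReal (‖WithLp.toLp 2 ((blockHerm (D, columnOf Z D y, q - cornerShift Z D y) + Z)⁻¹ *ᵥ
      blockBasis m)‖ ^ s) ≤
    ENNReal.ofReal ((1 + ∑ i, ‖y i‖ ^ 2) ^ (s / 2)) * ENNReal.ofReal |q| ^ (-s) := by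
  rcases eq_or_ne q 0 with rfl | hq
  · have h0 : 0 < 1 + ∑ i, ‖y i‖ ^ 2 := by positivity
    rw [abs_zero, ENNReal.ofReal_zero, ENNReal.zero_rpow_of_neg (neg_neg_of_pos hs),
      ENNReal.mul_top (by simpa using Real.rpow_pos_of_pos h0 _)]
    exact le_top
  obtain ⟨k, hk, hkv⟩ := blockHerm_add_mulVec Z D y q
  set M := blockHerm (D, columnOf Z D y, q - cornerShift Z D y) + Z with hM
  have hu : IsUnit M.det := (hZ.hermitian_add (blockHerm_isHermitian _)).isUnit_det
  have hk0 : k ≠ 0 := by rintro rfl; exact hq (by simpa using hk.symm)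
  have hsol : M⁻¹ *ᵥ blockBasis m = k⁻¹ • Sum.elim (1 : Unit → ℂ) y := by
    have : blockBasis m = k⁻¹ • (M *ᵥ Sum.elim 1 y) := by
      rw [hkv, smul_smul, inv_mul_cancel₀ hk0, one_smul]
    rw [this, mulVec_smul, mulVec_mulVec, nonsing_inv_mul _ hu, one_mulVec]
  have hnv : ‖WithLp.toLp 2 (Sum.elim (1 : Unit → ℂ) y)‖ = (1 + ∑ i, ‖y i‖ ^ 2) ^ (1 / 2 : ℝ) := by
    rw [EuclideanSpace.norm_eq, Real.sqrt_eq_rpow]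
    simp [Fintype.sum_sum_type]
  have hρ : 0 ≤ 1 + ∑ i, ‖y i‖ ^ 2 := by positivity
  have hqk : |q| ≤ ‖k‖ := hk ▸ Complex.abs_re_le_norm k
  have hq0 : 0 < |q| := abs_pos.mpr hq
  rw [ENNReal.ofReal_rpow_of_pos hq0, ← ENNReal.ofReal_mul (by positivity)]
  apply ENNReal.ofReal_le_ofReal
  rw [hsol, WithLp.toLp_smul, norm_smul, norm_inv, hnv, Real.mul_rpow (by positivity) (by positivity),
    ← Real.rpow_mul hρ, mul_comm, Real.rpow_neg hq0.le, Real.inv_rpow (norm_nonneg k)]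
  have : 1 / 2 * s = s / 2 := by ring
  rw [this]
  gcongr

lemma exists_det_add_smul_rankOne (Z : Matrix (Unit ⊕ Fin m) (Unit ⊕ Fin m) ℂ)
    (hZ : ImNeZero Z) (D : HermParam m) (y : Fin m → ℂ) (c : ℝ) :
    ∃ p0 p1 : ℂ, ∀ q : ℝ,
      (toHerm (D + (q * c) • rankOne y) + Z.toBlocks₂₂).det = p0 + p1 * q := by
  set A := toHerm D + Z.toBlocks₂₂ with hA
  have hu : IsUnit A.det :=
    ((imNeZero_toBlocks₂₂ hZ).hermitian_add (toHerm_isHermitian D)).isUnit_det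
  refine ⟨A.det, A.det * (c * (star y ⬝ᵥ (A⁻¹ *ᵥ y))), fun q => ?_⟩
  have : toHerm (D + (q * c) • rankOne y) + Z.toBlocks₂₂ =
      A + vecMulVec (((q * c : ℝ) : ℂ) • y) (star y) := by
    rw [toHerm_add, toHerm_smul, toHerm_rankOne, hA]
    ext i j
    simp [vecMulVec_apply]
    ring
  rw [this, vecMulVec_eq Unit, det_add_replicateCol_mul_replicateRow hu, Matrix.mul_assoc,
    ← replicateCol_mulVec, det_unique (n := Unit), mulVec_smul]
  simp [replicateRow_mul_replicateCol_apply]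
  ring

lemma exists_blockWeight_exponent (Z : Matrix (Unit ⊕ Fin m) (Unit ⊕ Fin m) ℂ)
    (D : HermParam m) (y : Fin m → ℂ) (c : ℝ) :
    ∃ β γ : ℝ, ∀ q : ℝ,
      (q - cornerShift Z (D + (q * c) • rankOne y) y) ^ 2 +
        2 * ∑ i, ‖columnOf Z (D + (q * c) • rankOne y) y i‖ ^ 2 +
        (trace (toHerm (D + (q * c) • rankOne y) * toHerm (D + (q * c) • rankOne y))).re =
      ((1 + c * (∑ i, ‖y i‖ ^ 2) ^ 2) ^ 2 + 2 * c ^ 2 * (∑ i, ‖y i‖ ^ 2) ^ 3 +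
        c ^ 2 * (∑ i, ‖y i‖ ^ 2) ^ 2) * q ^ 2 + β * q + γ := by
  set r := ∑ i, ‖y i‖ ^ 2 with hr
  have hrC : star y ⬝ᵥ y = (r : ℂ) := by
    simp [dotProduct, hr, Complex.conj_mul']
  have hcol : ∀ q : ℝ, ∀ i, columnOf Z (D + (q * c) • rankOne y) y i =
      columnOf Z D y i - ((q * (c * r) : ℝ) : ℂ) * y i := by
    intro q i
    have : toHerm (D + (q * c) • rankOne y) + Z.toBlocks₂₂ =
      toHerm D + Z.toBlocks₂₂ + (q * c : ℝ) • vecMulVec y (star y) := by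
      rw [toHerm_add, toHerm_smul, toHerm_rankOne]
      abel
    rw [columnOf, this, add_mulVec, smul_mulVec, vecMulVec_mulVec, hrC]
    simp [columnOf]
    ring
  have hshift : ∀ q : ℝ, cornerShift Z (D + (q * c) • rankOne y) y =
      cornerShift Z D y - q * (c * r ^ 2) := by
    intro q
    have hterm : ∀ i, (star (columnOf Z D y i - ((q * (c * r) : ℝ) : ℂ) * y i) +
        Z (Sum.inl ()) (Sum.inr i)) * y i =
        (star (columnOf Z D y i) + Z (Sum.inl ()) (Sum.inr i)) * y i -
          ((q * (c * r) : ℝ) : ℂ) * (star (y i) * y i) := by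
      intro i
      rw [star_sub, star_mul', Complex.star_def, Complex.conj_ofReal]
      ring
    have hrC' : ∑ i, star (y i) * y i = (r : ℂ) := hrC
    simp only [cornerShift, hcol, hterm]
    rw [Finset.sum_sub_distrib, ← Finset.mul_sum, hrC']
    simp only [Complex.add_re, Complex.sub_re, ← Complex.ofReal_mul, Complex.ofReal_re]
    ring
  have htr : ∀ q : ℝ, (trace (toHerm (D + (q * c) • rankOne y) *
      toHerm (D + (q * c) • rankOne y))).re = (trace (toHerm D * toHerm D)).re +
      q * (2 * c * (star y ⬝ᵥ (toHerm D *ᵥ y)).re) + q ^ 2 * (c ^ 2 * r ^ 2) := by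
    intro q
    have h1 : trace (toHerm D * vecMulVec y (star y)) = star y ⬝ᵥ (toHerm D *ᵥ y) := by
      rw [mul_vecMulVec, trace_vecMulVec, dotProduct_comm]
    have h2 : trace (vecMulVec y (star y) * vecMulVec y (star y)) = ((r ^ 2 : ℝ) : ℂ) := by
      rw [vecMulVec_mul_vecMulVec, hrC, trace_vecMulVec, dotProduct_smul, dotProduct_comm, hrC]
      simp [sq]
    rw [toHerm_add, toHerm_smul, toHerm_rankOne, Matrix.add_mul, Matrix.mul_add, Matrix.mul_add,
      trace_add, trace_add, trace_add, Matrix.smul_mul, Matrix.smul_mul, Matrix.mul_smul,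
      Matrix.mul_smul, trace_smul, trace_smul, trace_smul, trace_smul,
      trace_mul_comm (vecMulVec y (star y)), h1, h2]
    simp only [Complex.add_re, Complex.real_smul, Complex.re_ofReal_mul, Complex.ofReal_re]
    ring
  have hsq : ∀ q : ℝ, ∀ i, ‖columnOf Z (D + (q * c) • rankOne y) y i‖ ^ 2 =
      ‖columnOf Z D y i‖ ^ 2 + q * (- 2 * (c * r) * (columnOf Z D y i * star (y i)).re) +
        q ^ 2 * ((c * r) ^ 2 * ‖y i‖ ^ 2) := by
    intro q i
    rw [hcol]
    simp only [← Complex.normSq_eq_norm_sq, Complex.normSq_apply]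
    simp
    ring
  refine ⟨2 * (- 2 * (c * r) * ∑ i, (columnOf Z D y i * star (y i)).re) +
    2 * c * (star y ⬝ᵥ (toHerm D *ᵥ y)).re - 2 * (1 + c * r ^ 2) * cornerShift Z D y,
    cornerShift Z D y ^ 2 + 2 * ∑ i, ‖columnOf Z D y i‖ ^ 2 + (trace (toHerm D * toHerm D)).re,
    fun q => ?_⟩
  simp_rw [hsq]
  rw [Finset.sum_add_distrib, Finset.sum_add_distrib, ← Finset.mul_sum, ← Finset.mul_sum,
    ← Finset.mul_sum, ← Finset.mul_sum, ← hr, hshift, htr]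
  ring

lemma lintegral_norm_blockInv_mulVec_le {Z : Matrix (Unit ⊕ Fin m) (Unit ⊕ Fin m) ℂ}
    (hZ : ImNeZero Z) {w : ℝ} (hw : 0 < w) {s : ℝ} (hs0 : 0 < s) (hs1 : s < 1) :
    ∫⁻ p, ENNReal.ofReal (‖WithLp.toLp 2 ((blockHerm p + Z)⁻¹ *ᵥ blockBasis m)‖ ^ s) *
        blockWeight w p ≤
      ENNReal.ofReal (24 / (1 - s) + 1) * ENNReal.ofReal ((2 * w) ^ (s / 2)) *
        ∫⁻ p, blockWeight (m := m) w p := by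
  have hinv : Continuous fun p : HermParam m × (Fin m → ℂ) × ℝ => (blockHerm p + Z)⁻¹ :=
    continuous_inv_of_imNeZero (continuous_blockHerm.add continuous_const)
      fun p => hZ.hermitian_add (blockHerm_isHermitian p)
  have hFm : Measurable fun p : HermParam m × (Fin m → ℂ) × ℝ =>
      ENNReal.ofReal (‖WithLp.toLp 2 ((blockHerm p + Z)⁻¹ *ᵥ blockBasis m)‖ ^ s) *
        blockWeight w p := by
    refine Measurable.mul ?_ (measurable_blockWeight w)
    apply ENNReal.measurable_ofReal.comp
    refine Measurable.pow_const ?_ s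
    apply Continuous.measurable
    have := hinv.matrix_mulVec (continuous_const (y := blockBasis m))
    exact ((PiLp.continuous_toLp 2 _).comp this).norm
  set c : (Fin m → ℂ) → ℝ := fun y => -1 / (1 + ∑ i, ‖y i‖ ^ 2) ^ 2 with hc
  rw [lintegral_block_eq hZ _ hFm c, lintegral_block_eq hZ _ (measurable_blockWeight w) c,
    ← lintegral_const_mul' _ _ (by finiteness)]
  refine lintegral_mono fun y => ?_
  rw [← lintegral_const_mul' _ _ (by finiteness)]
  refine lintegral_mono fun D => ?_
  set r := ∑ i, ‖y i‖ ^ 2 with hr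
  have hr0 : 0 ≤ r := by positivity
  have hcy : c y = -1 / (1 + r) ^ 2 := rfl
  obtain ⟨p0, p1, hp⟩ := exists_det_add_smul_rankOne Z hZ D y (c y)
  obtain ⟨β, γ, hβ⟩ := exists_blockWeight_exponent Z D y (c y)
  rw [← hr] at hβ
  set α := (1 + c y * r ^ 2) ^ 2 + 2 * c y ^ 2 * r ^ 3 + c y ^ 2 * r ^ 2 with hα
  have hαeq : α = (1 + 4 * r + 5 * r ^ 2 + 2 * r ^ 3) / (1 + r) ^ 4 := by
    rw [hα, hcy]
    field_simp
    ring
  have hα0 : 0 < α := by rw [hαeq]; positivity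
  have hαρ : (1 + r) * α ≤ 2 := by
    rw [hαeq, mul_div_assoc', div_le_iff₀ (by positivity)]
    have h1 : 0 ≤ r ^ 4 := by positivity
    have h2 : 0 ≤ r ^ 3 := by positivity
    have h3 : 0 ≤ r ^ 2 := by positivity
    nlinarith
  have hweight : ∀ q : ℝ, ENNReal.ofReal
      (‖(toHerm (D + (q * c y) • rankOne y) + Z.toBlocks₂₂).det‖ ^ 2) *
      blockWeight w (D + (q * c y) • rankOne y, columnOf Z (D + (q * c y) • rankOne y) y,
        q - cornerShift Z (D + (q * c y) • rankOne y) y) =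
      ENNReal.ofReal (‖p0 + p1 * q‖ ^ 2 *
        Real.exp (-((w * α) * q ^ 2 + (w * β) * q + w * γ))) := by
    intro q
    rw [hp, blockWeight, ← ENNReal.ofReal_mul (by positivity), hβ]
    congr 4
    ring
  simp_rw [hweight]
  calc _ ≤ ∫⁻ q : ℝ, ENNReal.ofReal ((1 + r) ^ (s / 2)) * (ENNReal.ofReal |q| ^ (-s) *
        ENNReal.ofReal (‖p0 + p1 * q‖ ^ 2 *
          Real.exp (-((w * α) * q ^ 2 + (w * β) * q + w * γ)))) := by
        refine lintegral_mono fun q => ?_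
        rw [mul_left_comm, hweight, ← mul_assoc]
        gcongr
        exact norm_blockInv_mulVec_rpow_le hZ _ y q hs0
    _ ≤ ENNReal.ofReal ((1 + r) ^ (s / 2)) * (ENNReal.ofReal (24 / (1 - s) + 1) *
        ENNReal.ofReal (w * α) ^ (s / 2) * ∫⁻ q : ℝ, ENNReal.ofReal (‖p0 + p1 * q‖ ^ 2 *
          Real.exp (-((w * α) * q ^ 2 + (w * β) * q + w * γ)))) := by
        rw [lintegral_const_mul' _ _ (by finiteness)]
        gcongr
        exact lintegral_rpow_neg_mul_le s hs0 hs1 _ _ _ (by positivity) p0 p1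
    _ ≤ _ := by
        rw [← mul_assoc]
        refine mul_le_mul_left ?_ _
        rw [mul_left_comm]
        refine mul_le_mul_right ?_ _
        rw [ENNReal.ofReal_rpow_of_pos (by positivity), ← ENNReal.ofReal_mul (by positivity),
          ← Real.mul_rpow (by positivity) (by positivity)]
        apply ENNReal.ofReal_le_ofReal
        exact Real.rpow_le_rpow (by positivity) (by nlinarith) (by positivity)

end BlockBound

section Rotation

variable {m : ℕ}

/-- The Gaussian weight on Hermitian matrices. -/
def hermWeight {W : ℕ} (w : ℝ) (x : HermParam W) : ℝ≥0∞ :=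
  ENNReal.ofReal (Real.exp (-w * (trace (toHerm x * toHerm x)).re))

lemma continuous_trace_toHerm_sq {W : ℕ} :
    Continuous fun x : HermParam W => (trace (toHerm x * toHerm x)).re :=
  Complex.continuous_re.comp (continuous_toHerm.matrix_mul continuous_toHerm).matrix_trace

lemma measurable_hermWeight {W : ℕ} (w : ℝ) : Measurable (hermWeight (W := W) w) := by
  have := continuous_trace_toHerm_sq (W := W)
  unfold hermWeight
  apply ENNReal.measurable_ofReal.comp
  apply Continuous.measurable
  fun_prop

lemma exists_unitary_mulVec_blockBasis (φ : Fin (m + 1) → ℂ) (hφ : ‖WithLp.toLp 2 φ‖ = 1) :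
    ∃ U : Matrix (Fin (m + 1)) (Unit ⊕ Fin m) ℂ, Uᴴ * U = 1 ∧ U * Uᴴ = 1 ∧
      U *ᵥ blockBasis m = φ := by
  have hcard : Module.finrank ℂ (EuclideanSpace ℂ (Fin (m + 1))) = Fintype.card (Unit ⊕ Fin m) := by
    simp [add_comm]
  have hon : Orthonormal ℂ (({Sum.inl ()} : Set (Unit ⊕ Fin m)).domRestrict
      fun _ => WithLp.toLp 2 φ) := by
    refine ⟨fun i => hφ, fun i j hij => (hij (Subsingleton.elim i j)).elim⟩
  obtain ⟨b, hb⟩ := hon.exists_orthonormalBasis_extension_of_card_eq hcard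
  have h1 : (of fun i j => b j i : Matrix (Fin (m + 1)) (Unit ⊕ Fin m) ℂ)ᴴ *
      (of fun i j => b j i) = 1 := by
    ext i j
    have := orthonormal_iff_ite.mp b.orthonormal i j
    rw [one_apply, ← this, EuclideanSpace.inner_eq_star_dotProduct, dotProduct_comm]
    rfl
  refine ⟨_, h1, (mul_eq_one_comm_of_card_eq _ _ _ (by simp [add_comm])).mp h1, ?_⟩
  ext i
  simp [mulVec, dotProduct, blockBasis, Fintype.sum_sum_type, hb (Sum.inl ()) rfl]

lemma trace_blockHerm_sq (p : HermParam m × (Fin m → ℂ) × ℝ) :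
    (trace (blockHerm p * blockHerm p)).re =
      p.2.2 ^ 2 + 2 * ∑ i, ‖p.2.1 i‖ ^ 2 + (trace (toHerm p.1 * toHerm p.1)).re := by
  rw [blockHerm, fromBlocks_multiply]
  have h : ∀ i, (p.2.1 i).re * (p.2.1 i).re + (p.2.1 i).im * (p.2.1 i).im = ‖p.2.1 i‖ ^ 2 := by
    intro i
    rw [← Complex.normSq_eq_norm_sq, Complex.normSq_apply]
  simp [trace, mul_apply, Fintype.sum_sum_type, Finset.sum_add_distrib, h]
  ring

/-- Block coordinates of a Hermitian matrix rotated by `U`. -/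
def rotHerm (U : Matrix (Fin (m + 1)) (Unit ⊕ Fin m) ℂ) (p : HermParam m × (Fin m → ℂ) × ℝ) :
    HermParam (m + 1) := fromHerm (U * blockHerm p * Uᴴ)

lemma toHerm_rotHerm (U : Matrix (Fin (m + 1)) (Unit ⊕ Fin m) ℂ)
    (p : HermParam m × (Fin m → ℂ) × ℝ) : toHerm (rotHerm U p) = U * blockHerm p * Uᴴ :=
  toHerm_fromHerm (isHermitian_mul_mul_conjTranspose _ (blockHerm_isHermitian p))

lemma blockHerm_injective : Function.Injective (blockHerm (m := m)) := by
  intro p p' h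
  have h11 := congrFun (congrFun h (Sum.inl ())) (Sum.inl ())
  have h21 := fun i => congrFun (congrFun h (Sum.inr i)) (Sum.inl ())
  have h22 := congrArg (fun M => fromHerm M.toBlocks₂₂) h
  simp only [blockHerm, toBlocks_fromBlocks₂₂, fromHerm_toHerm] at h22
  refine Prod.ext h22 (Prod.ext (funext fun i => ?_) ?_)
  · simpa [blockHerm] using h21 i
  · simpa [blockHerm] using h11

lemma exists_blockHerm_eq {M : Matrix (Unit ⊕ Fin m) (Unit ⊕ Fin m) ℂ} (hM : M.IsHermitian) :
    ∃ p, blockHerm p = M := by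
  refine ⟨(fromHerm M.toBlocks₂₂, fun i => M (Sum.inr i) (Sum.inl ()),
    (M (Sum.inl ()) (Sum.inl ())).re), ?_⟩
  have h22 : M.toBlocks₂₂.IsHermitian := by
    ext i j
    exact hM.apply (Sum.inr i) (Sum.inr j)
  ext i j
  rcases i with i | i <;> rcases j with j | j
  · exact hM.coe_re_apply_self _
  · exact hM.apply _ _
  · rfl
  · exact congrFun (congrFun (toHerm_fromHerm h22) i) j

lemma blockHerm_add (p p' : HermParam m × (Fin m → ℂ) × ℝ) :
    blockHerm (p + p') = blockHerm p + blockHerm p' := by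
  ext i j
  rcases i with i | i <;> rcases j with j | j <;> simp [blockHerm, toHerm_add]

lemma blockHerm_smul (c : ℝ) (p : HermParam m × (Fin m → ℂ) × ℝ) :
    blockHerm (c • p) = c • blockHerm p := by
  ext i j
  rcases i with i | i <;> rcases j with j | j <;> simp [blockHerm, toHerm_smul]

lemma exists_lintegral_rotHerm {U : Matrix (Fin (m + 1)) (Unit ⊕ Fin m) ℂ} (hU : Uᴴ * U = 1)
    (hU' : U * Uᴴ = 1) : ∃ k : ℝ≥0∞, ∀ f : HermParam (m + 1) → ℝ≥0∞, Measurable f →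
      ∫⁻ x, f x = k * ∫⁻ p, f (rotHerm U p) := by
  let T : (HermParam m × (Fin m → ℂ) × ℝ) →ₗ[ℝ] HermParam (m + 1) :=
    { toFun := rotHerm U
      map_add' := fun p p' => by
        rw [rotHerm, blockHerm_add, Matrix.mul_add, Matrix.add_mul, fromHerm_add]; rfl
      map_smul' := fun c p => by
        rw [rotHerm, blockHerm_smul, Matrix.mul_smul, Matrix.smul_mul, fromHerm_smul]; rfl }
  have hconj : ∀ M : Matrix (Unit ⊕ Fin m) (Unit ⊕ Fin m) ℂ, Uᴴ * (U * M * Uᴴ) * U = M := by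
    intro M
    rw [Matrix.mul_assoc U, ← Matrix.mul_assoc Uᴴ, hU, Matrix.one_mul, Matrix.mul_assoc, hU,
      Matrix.mul_one]
  have hconj' : ∀ M : Mat (m + 1), U * (Uᴴ * M * U) * Uᴴ = M := by
    intro M
    rw [Matrix.mul_assoc Uᴴ, ← Matrix.mul_assoc U, hU', Matrix.one_mul, Matrix.mul_assoc, hU',
      Matrix.mul_one]
  have hT : Function.Bijective T := by
    constructor
    · intro p p' h
      have h' : toHerm (rotHerm U p) = toHerm (rotHerm U p') := congrArg toHerm h
      rw [toHerm_rotHerm, toHerm_rotHerm] at h'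
      apply blockHerm_injective
      rw [← hconj (blockHerm p), h', hconj]
    · intro x
      obtain ⟨p, hp⟩ := exists_blockHerm_eq
        (isHermitian_conjTranspose_mul_mul U (toHerm_isHermitian x))
      refine ⟨p, ?_⟩
      change fromHerm (U * blockHerm p * Uᴴ) = x
      rw [hp, hconj', fromHerm_toHerm]
  let L := (LinearEquiv.ofBijective T hT).toContinuousLinearEquiv
  have hL : Measurable L := L.continuous.measurable
  have := L.isAddHaarMeasure_map (volume : Measure (HermParam m × (Fin m → ℂ) × ℝ))
  refine ⟨Measure.addHaarScalarFactor (volume : Measure (HermParam (m + 1)))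
    (Measure.map L (volume : Measure (HermParam m × (Fin m → ℂ) × ℝ))), fun f hf => ?_⟩
  conv_lhs => rw [Measure.isAddLeftInvariant_eq_smul (volume : Measure (HermParam (m + 1)))
    (Measure.map L (volume : Measure (HermParam m × (Fin m → ℂ) × ℝ))), lintegral_smul_measure,
    lintegral_map hf hL]
  rfl

lemma lintegral_norm_inv_mulVec_le {Z : Mat (m + 1)} (hZ : ImNeZero Z) {w : ℝ} (hw : 0 < w)
    {s : ℝ} (hs0 : 0 < s) (hs1 : s < 1) (φ : Fin (m + 1) → ℂ) (hφ : ‖WithLp.toLp 2 φ‖ = 1) :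
    ∫⁻ x, ENNReal.ofReal (‖WithLp.toLp 2 ((toHerm x + Z)⁻¹ *ᵥ φ)‖ ^ s) * hermWeight w x ≤
      ENNReal.ofReal (24 / (1 - s) + 1) * ENNReal.ofReal ((2 * w) ^ (s / 2)) *
        ∫⁻ x : HermParam (m + 1), hermWeight w x := by
  obtain ⟨U, hU, hU', hUφ⟩ := exists_unitary_mulVec_blockBasis φ hφ
  obtain ⟨k, hk⟩ := exists_lintegral_rotHerm hU hU'
  have hinv : Continuous fun x : HermParam (m + 1) => (toHerm x + Z)⁻¹ :=
    continuous_inv_of_imNeZero (continuous_toHerm.add continuous_const)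
      fun x => hZ.hermitian_add (toHerm_isHermitian x)
  have hm : Measurable fun x : HermParam (m + 1) =>
      ENNReal.ofReal (‖WithLp.toLp 2 ((toHerm x + Z)⁻¹ *ᵥ φ)‖ ^ s) * hermWeight w x := by
    refine Measurable.mul ?_ (measurable_hermWeight w)
    apply ENNReal.measurable_ofReal.comp
    refine Measurable.pow_const ?_ s
    apply Continuous.measurable
    exact ((PiLp.continuous_toLp 2 _).comp (hinv.matrix_mulVec continuous_const)).norm
  have hUinj : ∀ x, x ≠ 0 → U *ᵥ x ≠ 0 := by
    intro x hx h
    apply hx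
    rw [← one_mulVec x, ← hU, ← mulVec_mulVec, h, mulVec_zero]
  have hZ' : ImNeZero (Uᴴ * Z * U) := hZ.conj hUinj
  rw [hk _ hm, hk _ (measurable_hermWeight w), mul_left_comm]
  refine mul_le_mul_right ?_ _
  have hwt : ∀ p, hermWeight w (rotHerm U p) = blockWeight w p := by
    intro p
    rw [hermWeight, blockWeight, ← trace_blockHerm_sq, toHerm_rotHerm]
    have : trace (U * blockHerm p * Uᴴ * (U * blockHerm p * Uᴴ)) =
        trace (blockHerm p * blockHerm p) := by
      rw [← Matrix.mul_assoc, ← Matrix.mul_assoc, Matrix.mul_assoc (U * blockHerm p), hU,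
        Matrix.mul_one, Matrix.mul_assoc U, trace_mul_comm, ← Matrix.mul_assoc, hU,
        Matrix.one_mul]
    rw [this]
  have hnorm : ∀ p, ‖WithLp.toLp 2 ((toHerm (rotHerm U p) + Z)⁻¹ *ᵥ φ)‖ =
      ‖WithLp.toLp 2 ((blockHerm p + Uᴴ * Z * U)⁻¹ *ᵥ blockBasis m)‖ := by
    intro p
    set B := blockHerm p + Uᴴ * Z * U with hB
    have hBu : IsUnit B.det := (hZ'.hermitian_add (blockHerm_isHermitian p)).isUnit_det
    have h1 : toHerm (rotHerm U p) + Z = U * B * Uᴴ := by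
      rw [toHerm_rotHerm, hB, Matrix.mul_add, Matrix.add_mul]
      congr 1
      rw [Matrix.mul_assoc Uᴴ, ← Matrix.mul_assoc U, hU', Matrix.one_mul, Matrix.mul_assoc, hU',
        Matrix.mul_one]
    have h2 : (toHerm (rotHerm U p) + Z)⁻¹ = U * B⁻¹ * Uᴴ := by
      apply inv_eq_right_inv
      rw [h1, Matrix.mul_assoc U B⁻¹, Matrix.mul_assoc (U * B), ← Matrix.mul_assoc Uᴴ, hU,
        Matrix.one_mul, Matrix.mul_assoc U B, ← Matrix.mul_assoc B, mul_nonsing_inv _ hBu,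
        Matrix.one_mul, hU']
    have h3 : ∀ v : Unit ⊕ Fin m → ℂ, ‖WithLp.toLp 2 (U *ᵥ v)‖ = ‖WithLp.toLp 2 v‖ := by
      intro v
      have key : star (U *ᵥ v) ⬝ᵥ (U *ᵥ v) = star v ⬝ᵥ v := by
        rw [star_mulVec_dotProduct, mulVec_mulVec, hU, one_mulVec]
      have e1 := EuclideanSpace.inner_eq_star_dotProduct (𝕜 := ℂ) (WithLp.toLp 2 (U *ᵥ v))
        (WithLp.toLp 2 (U *ᵥ v))
      have e2 := EuclideanSpace.inner_eq_star_dotProduct (𝕜 := ℂ) (WithLp.toLp 2 v)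
        (WithLp.toLp 2 v)
      rw [dotProduct_comm] at e1 e2
      rw [inner_self_eq_norm_sq_to_K] at e1 e2
      have e3 := e1.trans (key.trans e2.symm)
      exact (sq_eq_sq₀ (norm_nonneg _) (norm_nonneg _)).mp (by exact_mod_cast e3)
    rw [h2, ← hUφ, mulVec_mulVec, Matrix.mul_assoc, hU, Matrix.mul_one, ← mulVec_mulVec, h3]
  simp_rw [hwt, hnorm]
  exact lintegral_norm_blockInv_mulVec_le hZ' hw hs0 hs1

lemma lintegral_opNorm_inv_le {W : ℕ} (hW : 0 < W) {Z : Mat W} (hZ : ImNeZero Z)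
    {s : ℝ} (hs0 : 0 < s) (hs1 : s < 1) :
    ∫⁻ x, ENNReal.ofReal (opNorm (toHerm x + Z)⁻¹ ^ s) * hermWeight W x ≤
      ENNReal.ofReal (24 * (24 / (1 - s) + 1) * (W : ℝ) ^ s) *
        ∫⁻ x : HermParam W, hermWeight W x := by
  obtain ⟨m, rfl⟩ : ∃ m, W = m + 1 := ⟨W - 1, by omega⟩
  set w : ℝ := ((m + 1 : ℕ) : ℝ) with hw
  have hw0 : 0 < w := by positivity
  set K := 24 / (1 - s) + 1 with hK
  have hK0 : 0 ≤ K := by have : 0 < 1 - s := by linarith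
                         positivity
  have hsgn : ∀ ε : Fin (m + 1) → Bool,
      ∫⁻ x, ENNReal.ofReal (‖WithLp.toLp 2 ((toHerm x + Z)⁻¹ *ᵥ fun i => boolSign (ε i))‖ ^ s) *
        hermWeight w x ≤ ENNReal.ofReal (2 * K * w ^ s) *
          ∫⁻ x : HermParam (m + 1), hermWeight w x := by
    intro ε
    set e : Fin (m + 1) → ℂ := fun i => boolSign (ε i) with he
    have hen : ‖WithLp.toLp 2 e‖ = √w := by
      rw [EuclideanSpace.norm_eq]
      simp [he, norm_boolSign, hw]
    have hsw : 0 < √w := Real.sqrt_pos.mpr hw0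
    set φ : Fin (m + 1) → ℂ := ((√w)⁻¹ : ℂ) • e with hφ
    have hφn : ‖WithLp.toLp 2 φ‖ = 1 := by
      rw [hφ, WithLp.toLp_smul, norm_smul, hen, norm_inv, Complex.norm_real, Real.norm_of_nonneg hsw.le,
        inv_mul_cancel₀ hsw.ne']
    have heφ : e = (√w : ℂ) • φ := by
      rw [hφ, smul_smul, mul_inv_cancel₀ (by exact_mod_cast hsw.ne'), one_smul]
    have hpt : ∀ x, ENNReal.ofReal (‖WithLp.toLp 2 ((toHerm x + Z)⁻¹ *ᵥ e)‖ ^ s) =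
        ENNReal.ofReal (w ^ (s / 2)) *
          ENNReal.ofReal (‖WithLp.toLp 2 ((toHerm x + Z)⁻¹ *ᵥ φ)‖ ^ s) := by
      intro x
      rw [heφ, mulVec_smul, WithLp.toLp_smul, norm_smul, Complex.norm_real,
        Real.norm_of_nonneg hsw.le, Real.mul_rpow hsw.le (norm_nonneg _),
        ENNReal.ofReal_mul (by positivity), Real.sqrt_eq_rpow, ← Real.rpow_mul hw0.le]
      congr 3
      ring
    simp_rw [hpt, mul_assoc]
    rw [lintegral_const_mul' _ _ (by finiteness)]
    refine (mul_le_mul_right (lintegral_norm_inv_mulVec_le hZ hw0 hs0 hs1 φ hφn) _).trans ?_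
    rw [← mul_assoc, ← ENNReal.ofReal_mul hK0, ← ENNReal.ofReal_mul (by positivity)]
    refine mul_le_mul_left (ENNReal.ofReal_le_ofReal ?_) _
    have h2 : (2 : ℝ) ^ (s / 2) ≤ 2 := by
      calc (2 : ℝ) ^ (s / 2) ≤ 2 ^ (1 : ℝ) :=
            Real.rpow_le_rpow_of_exponent_le (by norm_num) (by linarith)
        _ = 2 := Real.rpow_one 2
    have h3 : w ^ (s / 2) * w ^ (s / 2) = w ^ s := by
      rw [← Real.rpow_add hw0]; congr 1; ring
    rw [Real.mul_rpow (by norm_num) hw0.le]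
    calc w ^ (s / 2) * (K * (2 ^ (s / 2) * w ^ (s / 2))) =
          2 ^ (s / 2) * (K * (w ^ (s / 2) * w ^ (s / 2))) := by ring
      _ = 2 ^ (s / 2) * (K * w ^ s) := by rw [h3]
      _ ≤ 2 * (K * w ^ s) := by gcongr
  have hinv : Continuous fun x : HermParam (m + 1) => (toHerm x + Z)⁻¹ :=
    continuous_inv_of_imNeZero (continuous_toHerm.add continuous_const)
      fun x => hZ.hermitian_add (toHerm_isHermitian x)
  have hm : ∀ ε : Fin (m + 1) → Bool, Measurable fun x : HermParam (m + 1) =>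
      ENNReal.ofReal (‖WithLp.toLp 2 ((toHerm x + Z)⁻¹ *ᵥ fun i => boolSign (ε i))‖ ^ s) *
        hermWeight w x := by
    intro ε
    refine Measurable.mul ?_ (measurable_hermWeight w)
    apply ENNReal.measurable_ofReal.comp
    refine Measurable.pow_const ?_ s
    apply Continuous.measurable
    exact ((PiLp.continuous_toLp 2 _).comp (hinv.matrix_mulVec continuous_const)).norm
  have h2N : (2 : ℝ≥0∞) ^ (m + 1) ≠ 0 := by positivity
  have h2N' : (2 : ℝ≥0∞) ^ (m + 1) ≠ ⊤ := by finiteness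
  refine (ENNReal.mul_le_mul_iff_right h2N h2N').mp ?_
  calc 2 ^ (m + 1) * ∫⁻ x, ENNReal.ofReal (opNorm (toHerm x + Z)⁻¹ ^ s) * hermWeight w x
      = ∫⁻ x, ENNReal.ofReal (2 ^ (m + 1) * opNorm (toHerm x + Z)⁻¹ ^ s) * hermWeight w x := by
        rw [← lintegral_const_mul' _ _ h2N']
        congr 1
        ext x
        rw [ENNReal.ofReal_mul (by positivity), ← mul_assoc]
        congr 2
        rw [ENNReal.ofReal_pow (by norm_num)]
        simp
    _ ≤ ∫⁻ x, 12 * ∑ ε : Fin (m + 1) → Bool,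
        ENNReal.ofReal (‖WithLp.toLp 2 ((toHerm x + Z)⁻¹ *ᵥ fun i => boolSign (ε i))‖ ^ s) *
          hermWeight w x := by
        refine lintegral_mono fun x => ?_
        have := ENNReal.ofReal_le_ofReal (opNorm_rpow_le_sum_signs s hs0 hs1 (toHerm x + Z)⁻¹)
        rw [ENNReal.ofReal_mul (p := 12) (by norm_num),
          ENNReal.ofReal_sum_of_nonneg (fun _ _ => by positivity)] at this
        rw [← Finset.sum_mul, ← mul_assoc]
        refine mul_le_mul_left ?_ _
        simpa using this
    _ = 12 * ∑ ε : Fin (m + 1) → Bool, ∫⁻ x,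
        ENNReal.ofReal (‖WithLp.toLp 2 ((toHerm x + Z)⁻¹ *ᵥ fun i => boolSign (ε i))‖ ^ s) *
          hermWeight w x := by
        rw [lintegral_const_mul' _ _ (by finiteness), lintegral_finsetSum _ fun ε _ => hm ε]
    _ ≤ 12 * ∑ ε : Fin (m + 1) → Bool, ENNReal.ofReal (2 * K * w ^ s) *
          ∫⁻ x : HermParam (m + 1), hermWeight w x := by
        gcongr with ε
        exact hsgn ε
    _ = 2 ^ (m + 1) * (ENNReal.ofReal (24 * K * w ^ s) *
          ∫⁻ x : HermParam (m + 1), hermWeight w x) := by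
        rw [Finset.sum_const, nsmul_eq_mul, Finset.card_univ]
        have : 24 * K * w ^ s = 12 * (2 * K * w ^ s) := by ring
        rw [this, ENNReal.ofReal_mul (p := 12) (by norm_num)]
        simp
        ring

end Rotation

section Transfer

variable {ι κ : Type*} [Fintype ι] [Fintype κ] [DecidableEq ι]

lemma star_dotProduct_self (x : κ → ℂ) : star x ⬝ᵥ x = ((‖WithLp.toLp 2 x‖ ^ 2 : ℝ) : ℂ) := by
  have e1 := EuclideanSpace.inner_eq_star_dotProduct (𝕜 := ℂ) (WithLp.toLp 2 x) (WithLp.toLp 2 x)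
  rw [dotProduct_comm, inner_self_eq_norm_sq_to_K] at e1
  rw [Complex.ofReal_pow]
  exact e1.symm

lemma abs_im_star_dotProduct_mulVec_le [DecidableEq κ] (M : Matrix κ κ ℂ) (x : κ → ℂ) :
    |(star x ⬝ᵥ (M *ᵥ x)).im| ≤ opNorm M * ‖WithLp.toLp 2 x‖ ^ 2 := by
  have e1 := EuclideanSpace.inner_eq_star_dotProduct (𝕜 := ℂ) (WithLp.toLp 2 x)
    (WithLp.toLp 2 (M *ᵥ x))
  rw [dotProduct_comm] at e1
  calc |(star x ⬝ᵥ (M *ᵥ x)).im| ≤ ‖star x ⬝ᵥ (M *ᵥ x)‖ := Complex.abs_im_le_norm _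
    _ = ‖inner ℂ (WithLp.toLp 2 x) (WithLp.toLp 2 (M *ᵥ x))‖ := by rw [e1]
    _ ≤ ‖WithLp.toLp 2 x‖ * ‖WithLp.toLp 2 (M *ᵥ x)‖ := norm_inner_le_norm _ _
    _ ≤ ‖WithLp.toLp 2 x‖ * (opNorm M * ‖WithLp.toLp 2 x‖) := by
        gcongr
        exact (toEuclideanCLM (𝕜 := ℂ) M).le_opNorm (WithLp.toLp 2 x)
    _ = _ := by ring

/-- The matrix `H - z` with an additional imaginary part on the ranges of `E` and `F`. -/
def regularized (H : Matrix ι ι ℂ) (E F : Matrix ι κ ℂ) (z : ℂ) (η : ℝ) : Matrix ι ι ℂ :=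
  H - z • 1 - (η * Complex.I) • (E * Eᴴ + F * Fᴴ)

lemma im_regularized {H : Matrix ι ι ℂ} (hH : H.IsHermitian) (E F : Matrix ι κ ℂ) (z : ℂ) (η : ℝ)
    (x : ι → ℂ) : (star x ⬝ᵥ (regularized H E F z η *ᵥ x)).im =
      -(z.im * ‖WithLp.toLp 2 x‖ ^ 2 +
        η * (‖WithLp.toLp 2 (Eᴴ *ᵥ x)‖ ^ 2 + ‖WithLp.toLp 2 (Fᴴ *ᵥ x)‖ ^ 2)) := by
  have h1 : ∀ A : Matrix ι κ ℂ, star x ⬝ᵥ ((A * Aᴴ) *ᵥ x) =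
      ((‖WithLp.toLp 2 (Aᴴ *ᵥ x)‖ ^ 2 : ℝ) : ℂ) := by
    intro A
    rw [← star_dotProduct_self, star_mulVec_dotProduct, conjTranspose_conjTranspose, mulVec_mulVec]
  rw [regularized, sub_mulVec, sub_mulVec, smul_mulVec, smul_mulVec, one_mulVec, add_mulVec,
    dotProduct_sub, dotProduct_sub, dotProduct_smul, dotProduct_smul, dotProduct_add, h1, h1,
    star_dotProduct_self, Complex.sub_im, Complex.sub_im,
    im_star_dotProduct_mulVec_of_isHermitian hH, ← Complex.ofReal_add]
  simp only [smul_eq_mul, Complex.mul_im, Complex.ofReal_re, Complex.ofReal_im, Complex.mul_re,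
    Complex.I_re, Complex.I_im]
  ring

lemma imNeZero_regularized {H : Matrix ι ι ℂ} (hH : H.IsHermitian) (E F : Matrix ι κ ℂ) {z : ℂ}
    {η : ℝ} (hη : 0 < η * z.im) : ImNeZero (regularized H E F z η) := by
  intro x hx h
  rw [im_regularized hH, neg_eq_zero] at h
  have hx' : 0 < ‖WithLp.toLp 2 x‖ := norm_pos_iff.mpr (by simpa using hx)
  have h2 : 0 < η * z.im * ‖WithLp.toLp 2 x‖ ^ 2 := by positivity
  have h3 : 0 ≤ η ^ 2 * (‖WithLp.toLp 2 (Eᴴ *ᵥ x)‖ ^ 2 + ‖WithLp.toLp 2 (Fᴴ *ᵥ x)‖ ^ 2) := by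
    positivity
  have := congrArg (η * ·) h
  simp only [mul_zero] at this
  nlinarith

lemma imNeZero_sub_smul_one {H : Matrix ι ι ℂ} (hH : H.IsHermitian) {z : ℂ} (hz : z.im ≠ 0) :
    ImNeZero (H - z • 1) := by
  have h := imNeZero_regularized hH (0 : Matrix ι ι ℂ) 0 (z := z) (η := z.im)
    (mul_self_pos.mpr hz)
  simpa [regularized] using h

lemma false_of_quadratic_bounds {e t r0 r1 S qu q0 q1 n0 n1 : ℝ} (he : 0 < e) (het : e * t = 1)
    (hS : 0 < S) (hr0 : 0 ≤ r0) (hr1 : 0 ≤ r1) (hlow : e ^ 2 * S < qu) (hup : qu ≤ 2 * q0 + 2 * q1)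
    (hq0 : q0 ≤ e * (r0 * n0)) (hq1 : q1 ≤ e * (r1 * n1)) (hn0 : n0 ≤ e ^ 2 * S)
    (hn1 : n1 ≤ 4 * (e ^ 2 * S)) (h : 2 * r0 + 8 * r1 ≤ t) : False := by
  have h0 : e * (r0 * n0) ≤ e * (r0 * (e ^ 2 * S)) := by gcongr
  have h1 : e * (r1 * n1) ≤ e * (r1 * (4 * (e ^ 2 * S))) := by gcongr
  have h2 : e * (2 * r0 + 8 * r1) * (e ^ 2 * S) ≤ e * t * (e ^ 2 * S) := by gcongr
  rw [het] at h2
  linarith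

lemma sq_le_of_le_mul_add {n e x y : ℝ} (hn : 0 ≤ n) (h : n ≤ e * x + e * y) :
    n ^ 2 ≤ 4 * (e ^ 2 * (x ^ 2 + y ^ 2)) := by
  have h1 : n ^ 2 ≤ (e * x + e * y) ^ 2 := pow_le_pow_left₀ hn h 2
  nlinarith [sq_nonneg (e * x - e * y), sq_nonneg (e * x), sq_nonneg (e * y)]

set_option maxHeartbeats 800000 in
/-- The off-diagonal block of the resolvent is controlled by the diagonal blocks of the
regularized resolvent. -/
lemma opNorm_conj_inv_le [DecidableEq κ] {H : Matrix ι ι ℂ} (hH : H.IsHermitian)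
    (E F : Matrix ι κ ℂ) {z : ℂ} {η t : ℝ} (hη : 0 < η * z.im) (ht : 0 < t) (hηt : |η| * t = 1)
    (h : 2 * opNorm (Eᴴ * (regularized H E F z η)⁻¹ * E) +
      8 * opNorm (Fᴴ * (regularized H E F z η)⁻¹ * F) ≤ t) :
    opNorm (Eᴴ * (H - z • 1)⁻¹ * F) ≤ t := by
  set L := regularized H E F z η with hL
  have hLu : IsUnit L.det := (imNeZero_regularized hH E F hη).isUnit_det
  have hz : z.im ≠ 0 := by rintro h0; simp [h0] at hη
  have hGu : IsUnit (H - z • 1).det := (imNeZero_sub_smul_one hH hz).isUnit_det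
  refine ContinuousLinearMap.opNorm_le_bound _ ht.le fun a' => ?_
  obtain ⟨a, rfl⟩ := (WithLp.toLp_surjective 2) a'
  rw [toEuclideanCLM_toLp]
  by_contra! hlt
  set u := (H - z • 1)⁻¹ *ᵥ (F *ᵥ a) with hu
  have hu0 : (Eᴴ * (H - z • 1)⁻¹ * F) *ᵥ a = Eᴴ *ᵥ u := by
    rw [hu, mulVec_mulVec, mulVec_mulVec, Matrix.mul_assoc]
  rw [hu0] at hlt
  set u0 := Eᴴ *ᵥ u with hu0'
  set u1 := Fᴴ *ᵥ u with hu1'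
  set w0 : κ → ℂ := -((η * Complex.I) • u0) with hw0
  set w1 : κ → ℂ := a - (η * Complex.I) • u1 with hw1
  have hLuw : L *ᵥ u = E *ᵥ w0 + F *ᵥ w1 := by
    have : (H - z • 1) *ᵥ u = F *ᵥ a := by
      rw [hu, mulVec_mulVec, mul_nonsing_inv _ hGu, one_mulVec]
    rw [hL, regularized, sub_mulVec, this, hw0, hw1, smul_mulVec, add_mulVec, ← mulVec_mulVec,
      ← mulVec_mulVec, mulVec_neg, mulVec_sub, mulVec_smul, mulVec_smul, smul_add]
    abel
  set q : (ι → ℂ) → ℝ := fun v => (star v ⬝ᵥ (L⁻¹ *ᵥ v)).im with hq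
  have hqL : ∀ v, q (L *ᵥ v) = z.im * ‖WithLp.toLp 2 v‖ ^ 2 +
        η * (‖WithLp.toLp 2 (Eᴴ *ᵥ v)‖ ^ 2 + ‖WithLp.toLp 2 (Fᴴ *ᵥ v)‖ ^ 2) := by
    intro v
    have : L⁻¹ *ᵥ (L *ᵥ v) = v := by rw [mulVec_mulVec, nonsing_inv_mul _ hLu, one_mulVec]
    simp only [hq]
    rw [this, im_star_dotProduct_comm, im_regularized hH, neg_neg]
  have hqpos : ∀ v, 0 ≤ η * q v := by
    intro v
    have : v = L *ᵥ (L⁻¹ *ᵥ v) := by rw [mulVec_mulVec, mul_nonsing_inv _ hLu, one_mulVec]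
    rw [this, hqL]
    set v' := L⁻¹ *ᵥ v
    have h1 : 0 ≤ η * z.im * ‖WithLp.toLp 2 v'‖ ^ 2 := by positivity
    have h2 : 0 ≤ η ^ 2 * (‖WithLp.toLp 2 (Eᴴ *ᵥ v')‖ ^ 2 + ‖WithLp.toLp 2 (Fᴴ *ᵥ v')‖ ^ 2) := by
      positivity
    nlinarith
  have hpar : ∀ v v', q (v + v') + q (v - v') = 2 * q v + 2 * q v' := by
    intro v v'
    simp only [hq, star_add, star_sub, mulVec_add, mulVec_sub, add_dotProduct, sub_dotProduct,
      dotProduct_add, dotProduct_sub, Complex.add_im, Complex.sub_im]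
    ring
  have hqconj : ∀ (A : Matrix ι κ ℂ) (x : κ → ℂ),
      |q (A *ᵥ x)| ≤ opNorm (Aᴴ * L⁻¹ * A) * ‖WithLp.toLp 2 x‖ ^ 2 := by
    intro A x
    have : star (A *ᵥ x) ⬝ᵥ (L⁻¹ *ᵥ (A *ᵥ x)) = star x ⬝ᵥ ((Aᴴ * L⁻¹ * A) *ᵥ x) := by
      rw [star_mulVec_dotProduct, mulVec_mulVec, mulVec_mulVec, Matrix.mul_assoc]
    simp only [hq]
    rw [this]
    exact abs_im_star_dotProduct_mulVec_le _ _
  set r0 := opNorm (Eᴴ * L⁻¹ * E) with hr0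
  set r1 := opNorm (Fᴴ * L⁻¹ * F) with hr1
  have hr0n : 0 ≤ r0 := norm_nonneg _
  have hr1n : 0 ≤ r1 := norm_nonneg _
  have hη0 : 0 < |η| := by
    rw [abs_pos]; rintro rfl; simp at hη
  set S2 := ‖WithLp.toLp 2 u0‖ ^ 2 + ‖WithLp.toLp 2 u1‖ ^ 2 with hS2
  have hηI : ‖(η * Complex.I : ℂ)‖ = |η| := by simp
  have hn0 : ‖WithLp.toLp 2 w0‖ ^ 2 ≤ |η| ^ 2 * S2 := by
    rw [hw0, WithLp.toLp_neg, norm_neg, WithLp.toLp_smul, norm_smul, hηI, mul_pow]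
    gcongr
    exact le_add_of_nonneg_right (by positivity)
  have ha : ‖WithLp.toLp 2 a‖ ≤ |η| * ‖WithLp.toLp 2 u0‖ := by
    calc ‖WithLp.toLp 2 a‖ = |η| * (t * ‖WithLp.toLp 2 a‖) := by rw [← mul_assoc, hηt, one_mul]
      _ ≤ |η| * ‖WithLp.toLp 2 u0‖ := mul_le_mul_of_nonneg_left hlt.le hη0.le
  have hn1 : ‖WithLp.toLp 2 w1‖ ^ 2 ≤ 4 * (|η| ^ 2 * S2) := by
    have h1 : ‖WithLp.toLp 2 w1‖ ≤ |η| * ‖WithLp.toLp 2 u0‖ + |η| * ‖WithLp.toLp 2 u1‖ := by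
      rw [hw1, WithLp.toLp_sub]
      refine (norm_sub_le _ _).trans ?_
      rw [WithLp.toLp_smul, norm_smul, hηI]
      gcongr
    exact sq_le_of_le_mul_add (norm_nonneg _) h1
  have hup : ‖WithLp.toLp 2 u0‖ ≠ 0 := by
    intro h0
    rw [h0] at hlt
    have : 0 ≤ t * ‖WithLp.toLp 2 a‖ := by positivity
    linarith
  have hupos : u ≠ 0 := by
    rintro h0
    apply hup
    rw [hu0', h0]
    simp
  have hS2pos : 0 < S2 := by
    have : 0 < ‖WithLp.toLp 2 u0‖ := lt_of_le_of_ne (norm_nonneg _) (Ne.symm hup)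
    positivity
  have hlow : |η| ^ 2 * S2 < η * q (L *ᵥ u) := by
    rw [hqL, sq_abs]
    have : 0 < ‖WithLp.toLp 2 u‖ := norm_pos_iff.mpr (by simpa using hupos)
    have h1 : 0 < η * z.im * ‖WithLp.toLp 2 u‖ ^ 2 := by positivity
    nlinarith
  have hbd : ∀ (A : Matrix ι κ ℂ) (x : κ → ℂ), η * q (A *ᵥ x) ≤
      |η| * (opNorm (Aᴴ * L⁻¹ * A) * ‖WithLp.toLp 2 x‖ ^ 2) := by
    intro A x
    refine (le_abs_self _).trans ?_
    rw [abs_mul]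
    exact mul_le_mul_of_nonneg_left (hqconj A x) hη0.le
  have hupp : η * q (L *ᵥ u) ≤ 2 * (η * q (E *ᵥ w0)) + 2 * (η * q (F *ᵥ w1)) := by
    have h1 := congrArg (η * ·) (hpar (E *ᵥ w0) (F *ᵥ w1))
    have h2 := hqpos (E *ᵥ w0 - F *ᵥ w1)
    rw [hLuw]
    simp only [mul_add] at h1
    linarith
  exact false_of_quadratic_bounds hη0 hηt hS2pos hr0n hr1n hlow hupp (hbd E w0) (hbd F w1)
    hn0 hn1 h

end Transfer

section Model

variable {n W : ℕ}

instance (n W : ℕ) : BorelSpace (ΩW n W) :=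
  haveI : BorelSpace (Fin n → HermParam W) := Pi.borelSpace (X := fun _ => HermParam W)
  Prod.borelSpace

lemma continuous_opNorm {ι : Type*} [Fintype ι] [DecidableEq ι] :
    Continuous (opNorm : Matrix ι ι ℂ → ℝ) :=
  (LinearMap.continuous_of_finiteDimensional
    ((toEuclideanCLM (n := ι) (𝕜 := ℂ)).toAlgEquiv.toLinearMap)).norm

lemma opNorm_nonneg {ι : Type*} [Fintype ι] [DecidableEq ι] (M : Matrix ι ι ℂ) : 0 ≤ opNorm M :=
  norm_nonneg _

/-- The embedding of the block at position `x`. -/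
def blockEmb (n W : ℕ) (x : Fin n) : Matrix (Fin n × Fin W) (Fin W) ℂ :=
  of fun p b => if p = (x, b) then 1 else 0

lemma blockEmb_conj (M : Matrix (Fin n × Fin W) (Fin n × Fin W) ℂ) (x y : Fin n) :
    (blockEmb n W x)ᴴ * M * blockEmb n W y = of fun a b => M (x, a) (y, b) := by
  ext a b
  simp [blockEmb, mul_apply, apply_ite]

lemma conjTranspose_blockEmb_mul_self (x : Fin n) :
    (blockEmb n W x)ᴴ * blockEmb n W x = 1 := by
  have := blockEmb_conj (1 : Matrix (Fin n × Fin W) (Fin n × Fin W) ℂ) x x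
  rw [Matrix.mul_one] at this
  rw [this]
  ext a b
  simp [one_apply]

lemma blockEmb_mul_mul_conjTranspose_apply (A : Mat W) (x : Fin n) (p q : Fin n × Fin W) :
    (blockEmb n W x * A * (blockEmb n W x)ᴴ) p q =
      if p.1 = x ∧ q.1 = x then A p.2 q.2 else 0 := by
  obtain ⟨p1, p2⟩ := p
  obtain ⟨q1, q2⟩ := q
  by_cases hp : p1 = x <;> by_cases hq : q1 = x <;>
    simp [blockEmb, mul_apply, apply_ite, hp, hq]

lemma Gblock_eq (ω : ΩW n W) (z : ℂ) (x y : Fin n) :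
    Gblock ω z x y = (blockEmb n W x)ᴴ * (hamOf ω - z • 1)⁻¹ * blockEmb n W y := by
  rw [blockEmb_conj]
  rfl

lemma hamOf_isHermitian (ω : ΩW n W) : (hamOf ω).IsHermitian := by
  ext p q
  have hV : ∀ j, star (Vm ω j q.2 p.2) = Vm ω j p.2 q.2 := by
    intro j
    simp only [Vm]
    split_ifs
    · exact (toHerm_isHermitian _).apply _ _
    · simp
  simp only [conjTranspose_apply, hamOf, ham, of_apply]
  rcases lt_trichotomy (p.1 : ℕ) q.1 with h | h | h
  · rw [if_neg h.ne', if_neg h.ne]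
    split_ifs <;> first | omega | simp
  · rw [if_pos h.symm, if_pos h, ← h, hV]
  · rw [if_neg h.ne, if_neg h.ne']
    split_ifs <;> first | omega | simp

lemma continuous_hamOf : Continuous (hamOf : ΩW n W → _) := by
  have hV : ∀ j a b, Continuous fun ω : ΩW n W => Vm ω j a b := by
    intro j a b
    simp only [Vm]
    split_ifs with h
    · exact (continuous_toHerm.comp (by fun_prop : Continuous fun ω : ΩW n W => ω.1 ⟨j, h⟩)
        ).matrix_elem a b
    · exact continuous_const
  have hT : ∀ j a b, Continuous fun ω : ΩW n W => Tm ω j a b := by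
    intro j a b
    simp only [Tm]
    split_ifs
    · simp only [of_apply]; fun_prop
    · exact continuous_const
  refine continuous_matrix fun p q => ?_
  simp only [hamOf, ham, of_apply]
  split_ifs
  · exact hV _ _ _
  · exact (hT _ _ _).neg
  · exact (hT _ _ _).star.neg
  · exact continuous_const

lemma toHerm_zero : toHerm (0 : HermParam W) = 0 := by
  have := toHerm_smul 0 (0 : HermParam W)
  rwa [zero_smul, zero_smul] at this

lemma hamOf_update (V : Fin n → HermParam W) (T : Fin (n - 1) → MatP W) (x : Fin n)
    (v : HermParam W) :
    hamOf (n := n) (W := W) (Function.update V x v, T) =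
      blockEmb n W x * toHerm v * (blockEmb n W x)ᴴ +
        hamOf (n := n) (W := W) (Function.update V x 0, T) := by
  ext p q
  rw [Matrix.add_apply, blockEmb_mul_mul_conjTranspose_apply]
  have hT : ∀ v, Tm (n := n) (W := W) (Function.update V x v, T) = Tm (V, T) := fun _ => rfl
  simp only [hamOf, ham, of_apply, hT]
  by_cases h : (p.1 : ℕ) = q.1
  · have h' : p.1 = q.1 := Fin.ext h
    simp only [if_true, Vm, Fin.is_lt, dif_pos, Fin.eta, h', and_self]
    by_cases hx : q.1 = x
    · simp [hx, toHerm_zero]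
    · simp [hx]
  · have : ¬ (p.1 = x ∧ q.1 = x) := by rintro ⟨rfl, h2⟩; exact h (by rw [h2])
    simp only [h, this, if_false, zero_add]

lemma wegnerDensity_update (V : Fin n → HermParam W) (T : Fin (n - 1) → MatP W) (x : Fin n)
    (v : HermParam W) :
    wegnerDensity n W (Function.update V x v, T) =
      hermWeight W v * wegnerDensity n W (Function.update V x 0, T) := by
  have hsum : ∀ v, ∑ j, (trace (toHerm (Function.update V x v j) *
      toHerm (Function.update V x v j))).re = (trace (toHerm v * toHerm v)).re +
        ∑ j ∈ Finset.univ.erase x, (trace (toHerm (V j) * toHerm (V j))).re := by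
    intro v
    rw [← Finset.add_sum_erase _ _ (Finset.mem_univ x)]
    congr 1
    · simp
    · refine Finset.sum_congr rfl fun j hj => ?_
      rw [Function.update_of_ne (Finset.ne_of_mem_erase hj)]
  simp only [wegnerDensity, hermWeight]
  rw [← ENNReal.ofReal_mul (Real.exp_nonneg _), ← Real.exp_add, hsum, hsum, toHerm_zero]
  simp only [Matrix.mul_zero, trace_zero, Complex.zero_re]
  congr 2
  ring

lemma measurable_wegnerDensity : Measurable (wegnerDensity n W) := by
  unfold wegnerDensity
  apply ENNReal.measurable_ofReal.comp
  apply Continuous.measurable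
  have h1 : ∀ j, Continuous fun ω : ΩW n W => (trace (toHerm (ω.1 j) * toHerm (ω.1 j))).re :=
    fun j => continuous_trace_toHerm_sq.comp (by fun_prop : Continuous fun ω : ΩW n W => ω.1 j)
  have h2 : ∀ j, Continuous fun ω : ΩW n W => (trace ((of (ω.2 j))ᴴ * of (ω.2 j))).re := by
    intro j
    have : Continuous fun ω : ΩW n W => (of (ω.2 j) : Mat W) :=
      continuous_matrix fun a b => by simp only [of_apply]; fun_prop
    exact Complex.continuous_re.comp (this.matrix_conjTranspose.matrix_mul this).matrix_trace
  exact (continuous_const.mul ((continuous_finsetSum _ fun j _ => h1 j).add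
    (continuous_finsetSum _ fun j _ => h2 j))).rexp

end Model

section Marginal

variable {n W : ℕ}

instance (n W : ℕ) : SigmaFinite (volume : Measure (Fin n → HermParam W)) :=
  Measure.pi.sigmaFinite fun _ => (volume : Measure (HermParam W))

instance (n W : ℕ) : SigmaFinite (volume : Measure (Fin n → MatP W)) :=
  Measure.pi.sigmaFinite fun _ => (volume : Measure (MatP W))

lemma continuous_opNorm_compress (x : Fin n)
    (E F : Matrix (Fin n × Fin W) (Fin W) ℂ) {z : ℂ} {η : ℝ} (hη : 0 < η * z.im) :
    Continuous fun ω : ΩW n W => opNorm ((blockEmb n W x)ᴴ *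
      (regularized (hamOf ω) E F z η)⁻¹ * blockEmb n W x) := by
  refine continuous_opNorm.comp ?_
  refine (continuous_const.matrix_mul (continuous_inv_of_imNeZero ?_ fun ω =>
    imNeZero_regularized (hamOf_isHermitian ω) E F hη)).matrix_mul continuous_const
  exact (continuous_hamOf.sub continuous_const).sub continuous_const

lemma lintegral_opNorm_compress_le (hW : 0 < W) (x : Fin n)
    (E F : Matrix (Fin n × Fin W) (Fin W) ℂ) {z : ℂ} {η : ℝ} (hη : 0 < η * z.im) {s : ℝ}
    (hs0 : 0 < s) (hs1 : s < 1) :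
    ∫⁻ ω, ENNReal.ofReal (opNorm ((blockEmb n W x)ᴴ *
        (regularized (hamOf ω) E F z η)⁻¹ * blockEmb n W x) ^ s) * wegnerDensity n W ω ≤
      ENNReal.ofReal (24 * (24 / (1 - s) + 1) * (W : ℝ) ^ s) *
        ∫⁻ ω, wegnerDensity n W ω := by
  have hm : Measurable fun ω : ΩW n W => ENNReal.ofReal (opNorm ((blockEmb n W x)ᴴ *
        (regularized (hamOf ω) E F z η)⁻¹ * blockEmb n W x) ^ s) * wegnerDensity n W ω := by
    refine Measurable.mul ?_ measurable_wegnerDensity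
    apply ENNReal.measurable_ofReal.comp
    refine Measurable.pow_const ?_ s
    exact (continuous_opNorm_compress x E F hη).measurable
  rw [Measure.volume_eq_prod, lintegral_prod_symm _ hm.aemeasurable,
    lintegral_prod_symm _ measurable_wegnerDensity.aemeasurable,
    ← lintegral_const_mul' _ _ (by finiteness)]
  refine lintegral_mono fun T => ?_
  have hT : Measurable fun V : Fin n → HermParam W => ((V, T) : ΩW n W) := by fun_prop
  rw [← lintegral_const_mul' _ _ (by finiteness), volume_pi]
  refine lintegral_le_of_lmarginal_le {x} (hm.comp hT)
    ((measurable_wegnerDensity.comp hT).const_mul _) fun V => ?_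
  rw [lmarginal_singleton, lmarginal_singleton]
  set L := regularized (hamOf (n := n) (W := W) (Function.update V x 0, T)) E F z η with hL
  have hLi : ImNeZero L := imNeZero_regularized (hamOf_isHermitian _) E F hη
  have hP := conjTranspose_blockEmb_mul_self (n := n) (W := W) x
  have hPinj : ∀ y, y ≠ 0 → blockEmb n W x *ᵥ y ≠ 0 := by
    intro y hy h
    apply hy
    rw [← one_mulVec y, ← hP, ← mulVec_mulVec, h, mulVec_zero]
  have hR : ∀ v, (blockEmb n W x)ᴴ * (regularized (hamOf (n := n) (W := W)
      (Function.update V x v, T)) E F z η)⁻¹ * blockEmb n W x =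
      (toHerm v + ((blockEmb n W x)ᴴ * L⁻¹ * blockEmb n W x)⁻¹)⁻¹ := by
    intro v
    rw [← hLi.compress_inv_add hP (toHerm_isHermitian v), hL, regularized, hamOf_update,
      regularized, add_sub_assoc, add_sub_assoc]
  have := lintegral_opNorm_inv_le hW (hLi.inv.conj hPinj).inv hs0 hs1
  set w₀ := wegnerDensity n W (Function.update V x 0, T) with hw₀
  have hfin : w₀ ≠ ⊤ := ENNReal.ofReal_ne_top
  calc _ = ∫⁻ v, ENNReal.ofReal (opNorm (toHerm v +
          ((blockEmb n W x)ᴴ * L⁻¹ * blockEmb n W x)⁻¹)⁻¹ ^ s) * hermWeight W v * w₀ := by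
        refine lintegral_congr fun v => ?_
        rw [mul_assoc, hw₀, ← wegnerDensity_update, ← hR v]
    _ = (∫⁻ v, ENNReal.ofReal (opNorm (toHerm v +
          ((blockEmb n W x)ᴴ * L⁻¹ * blockEmb n W x)⁻¹)⁻¹ ^ s) * hermWeight W v) * w₀ :=
        lintegral_mul_const' _ _ hfin
    _ ≤ ENNReal.ofReal (24 * (24 / (1 - s) + 1) * (W : ℝ) ^ s) *
          (∫⁻ v : HermParam W, hermWeight W v) * w₀ := mul_le_mul_left this _
    _ = _ := by
        rw [mul_assoc, ← lintegral_mul_const' _ _ hfin, ← lintegral_const_mul' _ _ (by finiteness)]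
        refine lintegral_congr fun v => ?_
        rw [hw₀, ← wegnerDensity_update]

end Marginal

section Tail

lemma lintegral_min_one_rpow_lt_top {s p : ℝ} (hs : 0 < s) (hsp : s < p) {A : ℝ≥0∞} (hA : A ≠ ⊤) :
    ∫⁻ t in Set.Ioi (0 : ℝ), min 1 (A * ENNReal.ofReal (t ^ (-p))) * ENNReal.ofReal (t ^ (s - 1)) <
      ⊤ := by
  rw [← Set.Ioc_union_Ioi_eq_Ioi zero_le_one]
  refine (lintegral_union_le _ _ _).trans_lt (ENNReal.add_lt_top.mpr ⟨?_, ?_⟩)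
  · have h : IntegrableOn (fun t : ℝ => t ^ (s - 1)) (Set.Ioc 0 1) :=
      (intervalIntegrable_iff_integrableOn_Ioc_of_le zero_le_one).mp
        (intervalIntegral.intervalIntegrable_rpow' (by linarith))
    refine lt_of_le_of_lt (lintegral_mono fun t => ?_) h.lintegral_lt_top
    exact mul_le_of_le_one_left zero_le (min_le_left _ _)
  · have h : IntegrableOn (fun t : ℝ => t ^ (s - 1 - p)) (Set.Ioi 1) :=
      integrableOn_Ioi_rpow_of_lt (by linarith) one_pos
    refine lt_of_le_of_lt (setLIntegral_mono' measurableSet_Ioi fun t ht => ?_)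
      ((lintegral_const_mul' A _ hA).trans_lt (ENNReal.mul_lt_top hA.lt_top h.lintegral_lt_top))
    have ht0 : (0 : ℝ) < t := one_pos.trans ht
    refine (mul_le_mul_left (min_le_right _ _) _).trans_eq ?_
    rw [mul_assoc, ← ENNReal.ofReal_mul (by positivity), ← Real.rpow_add ht0]
    congr 3
    ring

lemma lintegral_rpow_le_of_tail {α : Type*} [MeasurableSpace α] {μ : Measure α} {f : α → ℝ}
    (hf0 : ∀ a, 0 ≤ f a) (hf : Measurable f) {s p : ℝ} (hs : 0 < s) {A : ℝ≥0∞}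
    (h : ∀ t, 0 < t → μ {a | t < f a} ≤ A * ENNReal.ofReal (t ^ (-p)) * μ Set.univ) :
    ∫⁻ a, ENNReal.ofReal (f a ^ s) ∂μ ≤ ENNReal.ofReal s * (∫⁻ t in Set.Ioi (0 : ℝ),
      min 1 (A * ENNReal.ofReal (t ^ (-p))) * ENNReal.ofReal (t ^ (s - 1))) * μ Set.univ := by
  rw [lintegral_rpow_eq_lintegral_meas_lt_mul μ (Filter.Eventually.of_forall hf0)
    hf.aemeasurable hs, mul_assoc]
  refine mul_le_mul_right ?_ _
  rw [← lintegral_mul_const _ (by fun_prop)]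
  refine setLIntegral_mono' measurableSet_Ioi fun t ht => ?_
  rw [mul_right_comm]
  refine mul_le_mul_left ?_ _
  rw [min_mul, one_mul]
  exact le_min (measure_mono (Set.subset_univ _)) (h t ht)

end Tail

section Model

variable {n W : ℕ}

lemma wegnerRaw_opNorm_compress_ge_le (hW : 0 < W) (x : Fin n)
    (E F : Matrix (Fin n × Fin W) (Fin W) ℂ) {z : ℂ} {η : ℝ} (hη : 0 < η * z.im) {s : ℝ}
    (hs0 : 0 < s) (hs1 : s < 1) {t : ℝ} (ht : 0 < t) :
    wegnerRaw n W {ω | t * W / 16 ≤ opNorm ((blockEmb n W x)ᴴ *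
        (regularized (hamOf ω) E F z η)⁻¹ * blockEmb n W x)} ≤
      ENNReal.ofReal (24 * (24 / (1 - s) + 1) * 16 ^ s) * ENNReal.ofReal (t ^ (-s)) *
        wegnerRaw n W Set.univ := by
  have hW' : (0 : ℝ) < W := by exact_mod_cast hW
  have hc := (continuous_opNorm_compress x E F hη).measurable
  have hm : Measurable fun ω : ΩW n W => ENNReal.ofReal (opNorm ((blockEmb n W x)ᴴ *
        (regularized (hamOf ω) E F z η)⁻¹ * blockEmb n W x) ^ s) :=
    ENNReal.measurable_ofReal.comp (hc.pow_const s)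
  have hpos : 0 < (t * W / 16) ^ s := by positivity
  have hint : ∫⁻ ω, ENNReal.ofReal (opNorm ((blockEmb n W x)ᴴ *
        (regularized (hamOf ω) E F z η)⁻¹ * blockEmb n W x) ^ s) ∂(wegnerRaw n W) ≤
      ENNReal.ofReal (24 * (24 / (1 - s) + 1) * (W : ℝ) ^ s) * wegnerRaw n W Set.univ := by
    rw [wegnerRaw, lintegral_withDensity_eq_lintegral_mul _ measurable_wegnerDensity hm,
      withDensity_apply _ MeasurableSet.univ, Measure.restrict_univ]
    refine le_trans (lintegral_mono fun ω => ?_) (lintegral_opNorm_compress_le hW x E F hη hs0 hs1)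
    rw [Pi.mul_apply, mul_comm]
  have hsub : {ω | t * W / 16 ≤ opNorm ((blockEmb n W x)ᴴ *
        (regularized (hamOf ω) E F z η)⁻¹ * blockEmb n W x)} ⊆
      {ω | ENNReal.ofReal ((t * W / 16) ^ s) ≤ ENNReal.ofReal (opNorm ((blockEmb n W x)ᴴ *
        (regularized (hamOf ω) E F z η)⁻¹ * blockEmb n W x) ^ s)} := by
    intro ω hω
    exact ENNReal.ofReal_le_ofReal (Real.rpow_le_rpow (by positivity) hω hs0.le)
  refine (measure_mono hsub).trans ((meas_ge_le_lintegral_div hm.aemeasurable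
    (by simpa using hpos) ENNReal.ofReal_ne_top).trans ?_)
  refine ENNReal.div_le_of_le_mul (hint.trans_eq ?_)
  have h1s : 0 < 1 - s := by linarith
  rw [mul_right_comm _ (wegnerRaw n W Set.univ), ← ENNReal.ofReal_mul (by positivity),
    ← ENNReal.ofReal_mul (by positivity)]
  congr 2
  rw [Real.div_rpow (by positivity) (by norm_num), Real.mul_rpow ht.le hW'.le, Real.rpow_neg ht.le]
  have h1 : (16 : ℝ) ^ s ≠ 0 := by positivity
  have h2 : t ^ s ≠ 0 := by positivity
  field_simp

lemma continuous_opNorm_Gblock {z : ℂ} (hz : z.im ≠ 0) (x y : Fin n) :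
    Continuous fun ω : ΩW n W => opNorm (Gblock ω z x y) := by
  simp_rw [Gblock_eq]
  refine continuous_opNorm.comp ?_
  exact (continuous_const.matrix_mul (continuous_inv_of_imNeZero
    (continuous_hamOf.sub continuous_const) fun ω =>
    imNeZero_sub_smul_one (hamOf_isHermitian ω) hz)).matrix_mul continuous_const

lemma wegnerRaw_lt_opNorm_Gblock_le (hW : 0 < W) (x y : Fin n) {z : ℂ} (hz : z.im ≠ 0) {s : ℝ}
    (hs0 : 0 < s) (hs1 : s < 1) {t : ℝ} (ht : 0 < t) :
    wegnerRaw n W {ω | t < opNorm (Gblock ω z x y) / W} ≤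
      2 * ENNReal.ofReal (24 * (24 / (1 - s) + 1) * 16 ^ s) * ENNReal.ofReal (t ^ (-s)) *
        wegnerRaw n W Set.univ := by
  have hW' : (0 : ℝ) < W := by exact_mod_cast hW
  have htW : 0 < t * W := by positivity
  obtain ⟨η, hη, hηt⟩ : ∃ η : ℝ, 0 < η * z.im ∧ |η| * (t * W) = 1 := by
    refine ⟨(t * W)⁻¹ * (z.im / |z.im|), ?_, ?_⟩
    · have : (t * W)⁻¹ * (z.im / |z.im|) * z.im = (t * W)⁻¹ * (z.im ^ 2 / |z.im|) := by ring
      rw [this]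
      positivity
    · rw [abs_mul, abs_div, abs_abs, div_self (by positivity), mul_one,
        abs_of_pos (by positivity), inv_mul_cancel₀ htW.ne']
  set E := blockEmb n W x
  set F := blockEmb n W y
  have hsub : {ω | t < opNorm (Gblock ω z x y) / W} ⊆
      {ω | t * W / 16 ≤ opNorm (Eᴴ * (regularized (hamOf ω) E F z η)⁻¹ * E)} ∪
      {ω | t * W / 16 ≤ opNorm (Fᴴ * (regularized (hamOf ω) E F z η)⁻¹ * F)} := by
    intro ω hω
    rw [Set.mem_ofPred_eq, lt_div_iff₀ hW', Gblock_eq] at hω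
    by_contra h
    rw [Set.mem_union, not_or, Set.mem_ofPred_eq, Set.mem_ofPred_eq, not_le, not_le] at h
    refine hω.not_ge (opNorm_conj_inv_le (hamOf_isHermitian ω) E F hη htW hηt ?_)
    linarith [h.1, h.2]
  refine (measure_mono hsub).trans ((measure_union_le _ _).trans ?_)
  refine (add_le_add (wegnerRaw_opNorm_compress_ge_le hW x E F hη hs0 hs1 ht)
    (wegnerRaw_opNorm_compress_ge_le hW y E F hη hs0 hs1 ht)).trans_eq ?_
  ring

/-- The constant in the fractional moment bound. -/
def momentConst (s : ℝ) : ℝ≥0∞ :=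
  ENNReal.ofReal s * (∫⁻ t in Set.Ioi (0 : ℝ),
    min 1 (2 * ENNReal.ofReal (24 * (24 / (1 - (1 + s) / 2) + 1) * 16 ^ ((1 + s) / 2)) *
      ENNReal.ofReal (t ^ (-((1 + s) / 2)))) * ENNReal.ofReal (t ^ (s - 1)))

lemma momentConst_ne_top {s : ℝ} (hs0 : 0 < s) (hs1 : s < 1) : momentConst s ≠ ⊤ :=
  ENNReal.mul_ne_top ENNReal.ofReal_ne_top
    (lintegral_min_one_rpow_lt_top hs0 (by linarith) (by finiteness)).ne

lemma lintegral_opNorm_Gblock_le_of_im_ne_zero (hW : 0 < W) (x y : Fin n) {z : ℂ}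
    (hz : z.im ≠ 0) {s : ℝ} (hs0 : 0 < s) (hs1 : s < 1) :
    ∫⁻ ω, ENNReal.ofReal (opNorm (Gblock ω z x y) ^ s) ∂(wegnerRaw n W) ≤
      ENNReal.ofReal ((W : ℝ) ^ s) * (momentConst s * wegnerRaw n W Set.univ) := by
  have hW' : (0 : ℝ) < W := by exact_mod_cast hW
  have h := lintegral_rpow_le_of_tail (μ := wegnerRaw n W)
    (f := fun ω => opNorm (Gblock ω z x y) / W) (fun ω => div_nonneg (opNorm_nonneg _) hW'.le)
    ((continuous_opNorm_Gblock hz x y).measurable.div_const _) hs0 (fun t ht =>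
      wegnerRaw_lt_opNorm_Gblock_le hW x y hz (s := (1 + s) / 2) (by linarith) (by linarith) ht)
  refine le_trans (le_of_eq ?_) (mul_le_mul_right h _)
  rw [← lintegral_const_mul' _ _ ENNReal.ofReal_ne_top]
  refine lintegral_congr fun ω => ?_
  rw [← ENNReal.ofReal_mul (by positivity), ← Real.mul_rpow hW'.le
    (div_nonneg (opNorm_nonneg _) hW'.le), mul_div_cancel₀ _ hW'.ne']

lemma lintegral_opNorm_Gblock_le (hW : 0 < W) (x y : Fin n) (z : ℂ) {s : ℝ} (hs0 : 0 < s)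
    (hs1 : s < 1) :
    ∫⁻ ω, ENNReal.ofReal (opNorm (Gblock ω z x y) ^ s) ∂(wegnerRaw n W) ≤
      ENNReal.ofReal ((W : ℝ) ^ s) * (momentConst s * wegnerRaw n W Set.univ) := by
  by_cases hz : z.im ≠ 0
  · exact lintegral_opNorm_Gblock_le_of_im_ne_zero hW x y hz hs0 hs1
  rw [not_ne_iff] at hz
  set u : ℕ → ℂ := fun k => z + ((1 / ((k : ℝ) + 1) : ℝ) : ℂ) * Complex.I with hu
  have hu_im : ∀ k, (u k).im ≠ 0 := by
    intro k
    have : (u k).im = 1 / ((k : ℝ) + 1) := by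
      rw [hu, Complex.add_im, hz, Complex.im_ofReal_mul, Complex.I_im, mul_one, zero_add]
    rw [this]
    positivity
  have hu_lim : Filter.Tendsto u Filter.atTop (nhds z) := by
    have h1 := (Complex.continuous_ofReal.tendsto 0).comp
      (tendsto_one_div_add_atTop_nhds_zero_nat (𝕜 := ℝ))
    have h2 := (h1.mul_const Complex.I).const_add z
    simpa [hu] using h2
  have hlim : ∀ ω : ΩW n W, ENNReal.ofReal (opNorm (Gblock ω z x y) ^ s) ≤
      Filter.liminf (fun k => ENNReal.ofReal (opNorm (Gblock ω (u k) x y) ^ s)) Filter.atTop := by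
    intro ω
    by_cases hdet : IsUnit (hamOf ω - z • 1).det
    · refine (Filter.Tendsto.liminf_eq ?_).ge
      refine (ENNReal.continuous_ofReal.tendsto _).comp ?_
      refine Filter.Tendsto.rpow_const ?_ (Or.inr hs0.le)
      refine (continuous_opNorm.tendsto _).comp ?_
      simp_rw [Gblock_eq]
      have hinv : ContinuousAt (fun c : ℂ => (hamOf ω - c • 1)⁻¹) z := by
        have hc : Continuous fun c : ℂ => hamOf ω - c • 1 :=
          continuous_const.sub (continuous_id.smul continuous_const)
        simp_rw [inv_def, Ring.inverse_eq_inv']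
        exact (hc.matrix_det.continuousAt.inv₀ hdet.ne_zero).smul hc.matrix_adjugate.continuousAt
      have hcont : Continuous fun M : Matrix (Fin n × Fin W) (Fin n × Fin W) ℂ =>
          (blockEmb n W x)ᴴ * M * blockEmb n W y :=
        (continuous_const.matrix_mul continuous_id).matrix_mul continuous_const
      exact (hcont.tendsto _).comp (hinv.tendsto.comp hu_lim)
    · have h0 : Gblock ω z x y = 0 := by
        rw [Gblock_eq, nonsing_inv_apply_not_isUnit _ hdet, Matrix.mul_zero, Matrix.zero_mul]
      rw [h0, opNorm, map_zero, norm_zero, Real.zero_rpow hs0.ne', ENNReal.ofReal_zero]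
      exact zero_le
  refine (lintegral_mono hlim).trans ((lintegral_liminf_le fun k =>
    ENNReal.measurable_ofReal.comp
      ((continuous_opNorm_Gblock (hu_im k) x y).measurable.pow_const s)).trans ?_)
  refine (Filter.liminf_le_liminf (Filter.Eventually.of_forall fun k =>
    lintegral_opNorm_Gblock_le_of_im_ne_zero hW x y (hu_im k) hs0 hs1)).trans_eq ?_
  exact Filter.liminf_const _

end Model

theorem apriori_fractional_moment_bound :
    ∀ s ∈ Set.Ioo (0:ℝ) 1, ∃ C : ℝ, ∀ n W : ℕ, ∀ hn : 0 < n, 0 < W →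
    ∀ z : ℂ,
      (∫ ω, opNorm (Gblock ω z ⟨0, hn⟩ ⟨n - 1, by omega⟩) ^ s ∂(wegner n W)) ≤
        C * (W : ℝ) ^ s := by
  intro s hs
  refine ⟨(momentConst s).toReal, fun n W hn hW z => ?_⟩
  have hK := momentConst_ne_top hs.1 hs.2
  refine (le_abs_self _).trans ?_
  rw [← Real.norm_eq_abs]
  refine (norm_integral_le_lintegral_norm _).trans ?_
  have hW0 : 0 ≤ (W : ℝ) ^ s := by positivity
  refine ENNReal.toReal_le_of_le_ofReal (by positivity) ?_
  rw [ENNReal.ofReal_mul ENNReal.toReal_nonneg, ENNReal.ofReal_toReal hK, wegner,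
    lintegral_smul_measure, smul_eq_mul]
  have hnorm : ∀ ω : ΩW n W, ENNReal.ofReal
      ‖opNorm (Gblock ω z ⟨0, hn⟩ ⟨n - 1, by omega⟩) ^ s‖ =
      ENNReal.ofReal (opNorm (Gblock ω z ⟨0, hn⟩ ⟨n - 1, by omega⟩) ^ s) := fun ω => by
    rw [Real.norm_of_nonneg (Real.rpow_nonneg (opNorm_nonneg _) _)]
  simp_rw [hnorm]
  refine (mul_le_mul_right (lintegral_opNorm_Gblock_le hW _ _ z hs.1 hs.2) _).trans ?_
  calc (wegnerRaw n W Set.univ)⁻¹ * (ENNReal.ofReal ((W : ℝ) ^ s) *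
        (momentConst s * wegnerRaw n W Set.univ))
      = momentConst s * ENNReal.ofReal ((W : ℝ) ^ s) *
        ((wegnerRaw n W Set.univ)⁻¹ * wegnerRaw n W Set.univ) := by ring
    _ ≤ momentConst s * ENNReal.ofReal ((W : ℝ) ^ s) * 1 :=
        mul_le_mul_right (ENNReal.inv_mul_le_one _) _
    _ = _ := mul_one _

end RBM
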